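/- arXiv:1403.6933 — 4 statements merged into one kernel-verified Lean document; each statement's English description precedes it below -/
import Mathlib

section
/- For all integers n ≥ 1 and 0 ≤ m < n, and for each of the five pattern pairs (u,v) ∈ {(0021,0121), (0121,0132), (0121,1032), (0122,0132), (0122,1032)}, the number of ascent sequences of length n having exactly m ascents and avoiding both u and v equals the Narayana number N_{n,m+1} = (1/n)·binom(n,m+1)·binom(n,m). -/
/-- The number of ascents of a word of nonnegative integers. -/
def numAscents (w : List ℕ) : ℕ :=
  (w.zip w.tail).countP (fun p => p.1 < p.2)

/-- A word of nonnegative integers is an ascent sequence if it starts with 0 and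
each subsequent entry is at most one more than the number of ascents preceding it. -/
def IsAscentSeq (w : List ℕ) : Prop :=
  w.head? = some 0 ∧
    ∀ i (h : i < w.length), 1 ≤ i → w.get ⟨i, h⟩ ≤ numAscents (w.take i) + 1

/-- A word `π` contains the pattern `τ` if it has a subsequence order-isomorphic to `τ`. -/
def Contains (π τ : List ℕ) : Prop :=
  ∃ f : Fin τ.length → Fin π.length, StrictMono f ∧
    ∀ i j, (π.get (f i) < π.get (f j) ↔ τ.get i < τ.get j) ∧
      (π.get (f i) > π.get (f j) ↔ τ.get i > τ.get j)

/-- A word avoids a pattern if it does not contain it. -/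
def Avoids (π τ : List ℕ) : Prop := ¬ Contains π τ

/-- The number of ascent sequences of length `n` avoiding every pattern in `T`. -/
noncomputable def avoiderCount (n : ℕ) (T : List (List ℕ)) : ℕ :=
  {w : List ℕ | w.length = n ∧ IsAscentSeq w ∧ ∀ τ ∈ T, Avoids w τ}.ncard

/-- The number of ascent sequences of length `n` with exactly `m` ascents avoiding
every pattern in `T`. -/
noncomputable def avoiderCountAsc (n m : ℕ) (T : List (List ℕ)) : ℕ :=
  {w : List ℕ | w.length = n ∧ IsAscentSeq w ∧ numAscents w = m ∧ ∀ τ ∈ T, Avoids w τ}.ncard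

/-- The Narayana number `N_{n,m} = (1/n) C(n,m) C(n,m-1)` (the division is exact). -/
def narayana (n m : ℕ) : ℕ := n.choose m * n.choose (m - 1) / n

/-- The number of walks of `m` columns with `j` up steps and `t` down steps. -/
def walkCount : ℕ → ℕ → ℕ → ℚ
  | 0, j, t => if j = 0 ∧ t = 0 then 1 else 0
  | m + 1, j, t => (j - t : ℕ) / (m + 1) * (m + 1).choose j * (m + t).choose m

theorem walkCount_succ (m j t : ℕ) (h : t ≤ j) :
    walkCount (m + 1) (j + 1) t =
      ∑ s ∈ Finset.range (t + 1), (walkCount m (j + 1) s + walkCount m j s) := by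
  rcases m with _ | m
  · rcases j with _ | j
    · obtain rfl : t = 0 := by omega
      simp [walkCount]
    · simp [walkCount, Nat.choose_eq_zero_of_lt]
  · induction t with
    | zero =>
      have h1 : ((m + 2 : ℕ) : ℚ) * (m + 1).choose j = (m + 2).choose (j + 1) * (j + 1 : ℕ) := by
        exact_mod_cast Nat.add_one_mul_choose_eq (m + 1) j
      have h2 : ((m + 2).choose (j + 1) : ℚ) = (m + 1).choose j + (m + 1).choose (j + 1) := by
        exact_mod_cast Nat.choose_succ_succ (m + 1) j
      simp [walkCount]
      push_cast at h1 h2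
      field_simp
      rw [h2] at h1 ⊢
      linear_combination h1
    | succ t ih =>
      rw [Finset.sum_range_succ, ← ih (by omega)]
      obtain ⟨d, rfl⟩ := Nat.exists_eq_add_of_le h
      have h1 : ((m + 2 : ℕ) : ℚ) * (m + 1).choose (t + 1 + d) =
          (m + 2).choose (t + 1 + d + 1) * (t + 1 + d + 1 : ℕ) := by
        exact_mod_cast Nat.add_one_mul_choose_eq (m + 1) (t + 1 + d)
      have h2 : ((m + 2).choose (t + 1 + d + 1) : ℚ) =
          (m + 1).choose (t + 1 + d) + (m + 1).choose (t + 1 + d + 1) := by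
        exact_mod_cast Nat.choose_succ_succ (m + 1) (t + 1 + d)
      have h3 : ((m + 1 + (t + 1)).choose (m + 1) : ℚ) =
          (m + (t + 1)).choose m + (m + 1 + t).choose (m + 1) := by
        rw [show m + 1 + (t + 1) = (m + (t + 1)) + 1 by ring,
          show m + 1 + t = m + (t + 1) by ring]
        exact_mod_cast Nat.choose_succ_succ (m + (t + 1)) m
      have h4 : ((m + 1 + t).choose (m + 1) : ℚ) * (m + 1) = (m + (t + 1)).choose m * (t + 1) := by
        have := Nat.choose_succ_right_eq (m + (t + 1)) m
        rw [show m + (t + 1) - m = t + 1 by omega] at this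
        rw [show m + 1 + t = m + (t + 1) by ring]
        exact_mod_cast this
      simp only [walkCount]
      rw [show t + 1 + d + 1 - t = d + 2 by omega, show t + 1 + d + 1 - (t + 1) = d + 1 by omega,
        show t + 1 + d - (t + 1) = d by omega, h3]
      have h5 : ((m + 1 + t).choose (m + 1) : ℚ) = (m + (t + 1)).choose m * (t + 1) / (m + 1) := by
        field_simp; linarith
      have h6 : ((m + 1).choose (t + 1 + d) : ℚ) =
          (m + 2).choose (t + 1 + d + 1) * (t + d + 2) / (m + 2) := by
        field_simp; push_cast at h1; linarith
      have h7 : ((m + 1).choose (t + 1 + d + 1) : ℚ) =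
          (m + 2).choose (t + 1 + d + 1) - (m + 2).choose (t + 1 + d + 1) * (t + d + 2) / (m + 2) := by
        rw [← h6, h2]; ring
      rw [show m + 1 + 1 = m + 2 by ring, h5, h6, h7]
      push_cast
      field_simp
      ring

theorem sum_sub_mul_choose (m j : ℕ) :
    ∑ t ∈ Finset.range j, (j - t) * (m + t).choose m = (m + 1 + j).choose (m + 2) := by
  induction j with
  | zero => simp
  | succ j ih =>
    have h : ∀ t ∈ Finset.range (j + 1),
        (j + 1 - t) * (m + t).choose m = (j - t) * (m + t).choose m + (m + t).choose m := by
      intro t ht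
      rw [Nat.sub_add_comm (by simpa [Nat.lt_succ_iff] using ht)]
      ring
    have h' := Nat.sum_range_add_choose j m
    simp only [add_comm _ m] at h'
    rw [Finset.sum_congr rfl h, Finset.sum_add_distrib, Finset.sum_range_succ, ih, h',
      show m + 1 + (j + 1) = m + 1 + j + 1 by ring, Nat.choose_succ_succ (m + 1 + j) (m + 1)]
    rw [show m + j + 1 = m + 1 + j by ring]
    simp
    ring

theorem sum_walkCount (n m : ℕ) (hm : m ≤ n) :
    ∑ j ∈ Finset.range (m + 1), ∑ t ∈ Finset.range (j + 1),
      ((n + 1).choose (m + j) : ℚ) * walkCount m j t =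
      (n + 1).choose (m + 1) * (n + 1).choose m / (n + 1) := by
  rcases m with _ | m
  · simp [walkCount]
    field_simp
  have h1 : ∀ j ∈ Finset.range (m + 1), ∑ t ∈ Finset.range (j + 1 + 1),
      ((n + 1).choose (m + 1 + (j + 1)) : ℚ) * walkCount (m + 1) (j + 1) t =
      (n + 1).choose (m + 2) / (m + 1) * ((n - m - 1).choose j * (m + 1).choose (m - j) : ℕ) := by
    intro j hj
    rw [Finset.mem_range] at hj
    have h2 := sum_sub_mul_choose m (j + 1)
    have h3 : (n + 1).choose (m + j + 2) * (m + j + 2).choose (m + 2) =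
        (n + 1).choose (m + 2) * (n - m - 1).choose j := by
      by_cases hk : m + j + 2 ≤ n + 1
      · rw [Nat.choose_mul (by omega)]
        congr 2 <;> omega
      · rw [Nat.choose_eq_zero_of_lt (by omega), zero_mul]
        rcases Nat.lt_or_ge (n + 1) (m + 2) with h | h
        · simp [Nat.choose_eq_zero_of_lt h]
        · simp [Nat.choose_eq_zero_of_lt (show n - m - 1 < j by omega)]
    have h4 : (m + 1).choose (m - j) = (m + 1).choose (j + 1) :=
      Nat.choose_symm_of_eq_add (by omega)
    rw [Finset.sum_range_succ, ← Finset.mul_sum]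
    have h5 : ∑ t ∈ Finset.range (j + 1), walkCount (m + 1) (j + 1) t =
        (m + 1).choose (j + 1) / (m + 1) * (m + j + 2).choose (m + 2) := by
      rw [show m + j + 2 = m + 1 + (j + 1) by ring, ← h2]
      push_cast
      rw [Finset.mul_sum]
      refine Finset.sum_congr rfl fun t _ => ?_
      simp only [walkCount]
      ring
    have h3' : ((n + 1).choose (m + j + 2) : ℚ) * (m + j + 2).choose (m + 2) =
        (n + 1).choose (m + 2) * (n - m - 1).choose j := by exact_mod_cast h3
    rw [h5, h4, show m + 1 + (j + 1) = m + j + 2 by ring]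
    simp only [walkCount]
    push_cast
    simp only [Nat.sub_self, Nat.cast_zero, zero_div, zero_mul, mul_zero, add_zero]
    linear_combination ((m + 1).choose (j + 1) : ℚ) / (m + 1) * h3'
  have h6 : ∑ j ∈ Finset.range (m + 1), (n - m - 1).choose j * (m + 1).choose (m - j) =
      n.choose m := by
    rw [← Finset.Nat.sum_antidiagonal_eq_sum_range_succ
      (fun a b => (n - m - 1).choose a * (m + 1).choose b), ← Nat.add_choose_eq]
    congr 1
    omega
  have h7 : ((n + 1 : ℕ) : ℚ) * n.choose m = (n + 1).choose (m + 1) * (m + 1 : ℕ) := by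
    exact_mod_cast Nat.add_one_mul_choose_eq n m
  rw [Finset.sum_range_succ', Finset.sum_congr rfl h1, ← Finset.mul_sum]
  rw [← Nat.cast_sum, h6]
  simp [walkCount]
  push_cast at h7
  field_simp
  rw [show m + 1 + 1 = m + 2 by ring]
  linear_combination ((n + 1).choose (m + 2) : ℚ) * h7

/-- The number of ascents of the reverse of a word. -/
def ascRev : List ℕ → ℕ
  | x :: y :: w => ascRev (y :: w) + if y < x then 1 else 0
  | _ => 0

/-- The number of ascents starting from a zero in the reverse of a word. -/
def zeroAscRev : List ℕ → ℕ
  | x :: y :: w => zeroAscRev (y :: w) + if y = 0 ∧ 0 < x then 1 else 0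
  | _ => 0

/-- The largest entry of a word, or `1` if all entries are smaller. -/
def maxEntry : List ℕ → ℕ
  | x :: w => max x (maxEntry w)
  | [] => 1

/-- The letters that may follow the reverse of a word: `0`, a repeated letter `r M` where `M` is
the largest entry, and all letters larger than `M` permitted in an ascent sequence. -/
def nextLetters (r : ℕ → ℕ) (w : List ℕ) : Finset ℕ :=
  insert 0 (insert (r (maxEntry w)) (Finset.Ioc (maxEntry w) (ascRev w + 1)))

/-- The reverses of the words of length `n + 1` that start with `0` and are continued according to
`nextLetters r`. -/
def revWords (r : ℕ → ℕ) : ℕ → Finset (List ℕ)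
  | 0 => {[0]}
  | n + 1 => (revWords r n).biUnion fun w => (nextLetters r w).image (· :: w)

theorem one_le_maxEntry (w : List ℕ) : 1 ≤ maxEntry w := by
  induction w with
  | nil => simp [maxEntry]
  | cons x w ih => simp [maxEntry, ih]

theorem revWords_ne_nil {r : ℕ → ℕ} {n : ℕ} {w : List ℕ} (h : w ∈ revWords r n) : w ≠ [] := by
  cases n <;> simp [revWords] at h <;> aesop

theorem sum_revWords_succ (r : ℕ → ℕ) (n : ℕ) (f : List ℕ → ℕ) :
    ∑ w ∈ revWords r (n + 1), f w = ∑ w ∈ revWords r n, ∑ x ∈ nextLetters r w, f (x :: w) := by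
  rw [revWords, Finset.sum_biUnion]
  · refine Finset.sum_congr rfl fun w _ => Finset.sum_image ?_
    intro x _ y _ h
    exact (List.cons.inj h).1
  · intro v _ w _ hvw
    simp only [Function.onFun, Finset.disjoint_left, Finset.mem_image]
    rintro _ ⟨x, _, rfl⟩ ⟨y, _, h⟩
    exact hvw (List.cons.inj h).2.symm

theorem revWords_invariants {r : ℕ → ℕ} (hr : ∀ M, 1 ≤ M → 1 ≤ r M ∧ r M ≤ M) (n : ℕ) (y : ℕ)
    (w : List ℕ) (h : y :: w ∈ revWords r n) :
    maxEntry (y :: w) ≤ ascRev (y :: w) + 1 ∧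
      ascRev (y :: w) + 1 ≤ maxEntry (y :: w) + zeroAscRev (y :: w) ∧
      zeroAscRev (y :: w) ≤ ascRev (y :: w) ∧
      (y ≠ 0 → maxEntry (y :: w) ≤ ascRev (y :: w) ∧
        (r (maxEntry (y :: w)) = y ∨ maxEntry (y :: w) = y)) := by
  induction n generalizing y w with
  | zero =>
    simp only [revWords, Finset.mem_singleton, List.cons.injEq] at h
    obtain ⟨rfl, rfl⟩ := h
    simp [maxEntry, ascRev, zeroAscRev]
  | succ n ih =>
    simp only [revWords, Finset.mem_biUnion, Finset.mem_image, List.cons.injEq] at h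
    obtain ⟨v, hv, x, hx, rfl, rfl⟩ := h
    obtain ⟨z, v, rfl⟩ := List.exists_cons_of_ne_nil (revWords_ne_nil hv)
    have hM := one_le_maxEntry (z :: v)
    have hrM := hr _ hM
    obtain ⟨h1, h2, h3, h4⟩ := ih z v hv
    have hz : z ≤ maxEntry (z :: v) := le_max_left _ _
    rw [maxEntry, ascRev, zeroAscRev]
    simp only [nextLetters, Finset.mem_insert, Finset.mem_Ioc] at hx
    generalize maxEntry (z :: v) = M at *
    generalize ascRev (z :: v) = a at *
    generalize zeroAscRev (z :: v) = u at *
    rcases hx with rfl | rfl | ⟨hx, hx'⟩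
    · grind
    · rw [max_eq_right hrM.2]
      grind
    · rw [max_eq_left hx.le]
      grind

/-- A reversed word ends in a zero (`b = true`) or not, has `m` ascents, `j` of them from a zero,
and the largest entry `m + 1 + t - j`. -/
def HasState (b : Bool) (m j t : ℕ) (w : List ℕ) : Prop :=
  (w.head? = some 0 ↔ b) ∧ ascRev w = m ∧ zeroAscRev w = j ∧ maxEntry w + j = m + 1 + t

noncomputable instance (b : Bool) (m j t : ℕ) : DecidablePred (HasState b m j t) :=
  Classical.decPred _

theorem hasState_cons {b : Bool} {m j t y : ℕ} {w : List ℕ} :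
    HasState b m j t (y :: w) ↔ (y = 0 ↔ b) ∧ ascRev (y :: w) = m ∧ zeroAscRev (y :: w) = j ∧
      maxEntry (y :: w) + j = m + 1 + t := by
  simp [HasState]

/-- The number of words in `revWords r n` with the given state. -/
noncomputable def stateCount (r : ℕ → ℕ) (n : ℕ) (b : Bool) (m j t : ℕ) : ℕ :=
  ∑ w ∈ revWords r n, if HasState b m j t w then 1 else 0

theorem stateCount_succ_true {r : ℕ → ℕ} (hr : ∀ M, 1 ≤ M → 1 ≤ r M ∧ r M ≤ M) (n m j t : ℕ) :
    stateCount r (n + 1) true m j t = stateCount r n true m j t + stateCount r n false m j t := by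
  simp only [stateCount]
  rw [sum_revWords_succ, ← Finset.sum_add_distrib]
  refine Finset.sum_congr rfl fun w hw => ?_
  obtain ⟨y, w, rfl⟩ := List.exists_cons_of_ne_nil (revWords_ne_nil hw)
  have hM := one_le_maxEntry (y :: w)
  have hrM := hr _ hM
  rw [Finset.sum_eq_single_of_mem 0 (by simp [nextLetters])]
  · simp only [hasState_cons, ascRev, zeroAscRev]
    rw [maxEntry, max_eq_right (Nat.zero_le _)]
    by_cases hy : y = 0 <;> simp [hy]
  · intro x hx hx0
    simp [HasState, hx0]

theorem stateCount_succ_false {r : ℕ → ℕ} (hr : ∀ M, 1 ≤ M → 1 ≤ r M ∧ r M ≤ M) (n m j t : ℕ)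
    (ht : t ≤ j) :
    stateCount r (n + 1) false (m + 1) (j + 1) t = stateCount r n false (m + 1) (j + 1) t +
      ∑ s ∈ Finset.range (t + 1),
        (stateCount r n false m (j + 1) s + stateCount r n true m j s) := by
  simp only [stateCount, ← Finset.sum_add_distrib]
  rw [sum_revWords_succ, Finset.sum_comm, ← Finset.sum_add_distrib]
  refine Finset.sum_congr rfl fun w hw => ?_
  obtain ⟨y, w, rfl⟩ := List.exists_cons_of_ne_nil (revWords_ne_nil hw)
  have hM := one_le_maxEntry (y :: w)
  have hrM := hr _ hM
  obtain ⟨h1, h2, h3, h4⟩ := revWords_invariants hr n y w hw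
  rw [nextLetters, Finset.sum_insert (by simp; omega), Finset.sum_insert (by simp; omega)]
  have hmax : ∀ x, maxEntry (x :: y :: w) = max x (maxEntry (y :: w)) := fun _ => rfl
  have hz : y ≤ maxEntry (y :: w) := le_max_left _ _
  simp only [hasState_cons, ascRev, zeroAscRev, hmax, Bool.false_eq_true, iff_false, iff_true]
  obtain ⟨T, hT⟩ := Nat.exists_eq_add_of_le h2
  generalize maxEntry (y :: w) = M at *
  generalize ascRev (y :: w) = a at *
  generalize zeroAscRev (y :: w) = u at *
  have e1 : ∀ x ∈ Finset.Ioc M (a + 1),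
      (if ¬x = 0 ∧
        (a + if y < x then 1 else 0) = m + 1 ∧ (u + if y = 0 ∧ 0 < x then 1 else 0) = j + 1 ∧
        max x M + (j + 1) = m + 1 + 1 + t then 1 else 0) =
      if x = m + 1 + t - j then
        (if a = m ∧ (u + if y = 0 then 1 else 0) = j + 1 then 1 else 0) else 0 := by
    intro x hx
    rw [Finset.mem_Ioc] at hx
    rw [max_eq_left hx.1.le]
    split_ifs <;> first | rfl | omega
  have e2 : ∀ s ∈ Finset.range (t + 1),
      ((if ¬y = 0 ∧ a = m ∧ u = j + 1 ∧ M + (j + 1) = m + 1 + s then 1 else 0) +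
        if y = 0 ∧ a = m ∧ u = j ∧ M + j = m + 1 + s then 1 else 0) =
      if s = T then
        (if a = m ∧ (u + if y = 0 then 1 else 0) = j + 1 then 1 else 0) else 0 := by
    intro s _
    split_ifs <;> first | rfl | omega
  rw [Finset.sum_congr rfl e1, Finset.sum_congr rfl e2, Finset.sum_ite_eq', Finset.sum_ite_eq',
    max_eq_right hrM.2]
  simp only [Finset.mem_Ioc, Finset.mem_range, not_true_eq_false, false_and, if_false, zero_add]
  by_cases hy : y = 0
  · simp only [hy, true_and, not_true_eq_false, false_and, if_true, if_false, zero_add,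
      show 0 < r M by omega, show ¬ r M = 0 by omega, not_false_eq_true]
    split_ifs <;> first | rfl | omega
  · have hy' : ¬ y < r M := by
      have := h4 hy
      omega
    simp only [hy, hy', false_and, not_false_eq_true, true_and, if_false, add_zero,
      show ¬ r M = 0 by omega]
    split_ifs <;> first | rfl | omega

theorem stateCount_zero (r : ℕ → ℕ) (b : Bool) (m j t : ℕ) :
    stateCount r 0 b m j t = if b ∧ m = 0 ∧ j = 0 ∧ t = 0 then 1 else 0 := by
  simp only [stateCount, revWords, Finset.sum_singleton, hasState_cons, ascRev, zeroAscRev,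
    maxEntry]
  congr 1
  simp only [eq_iff_iff, true_iff]
  constructor
  · rintro ⟨h1, h2, h3, h4⟩
    exact ⟨by simpa using h1, h2.symm, h3.symm, by omega⟩
  · rintro ⟨h1, rfl, rfl, rfl⟩
    simp [h1]

theorem stateCount_false_eq_zero {r : ℕ → ℕ} (hr : ∀ M, 1 ≤ M → 1 ≤ r M ∧ r M ≤ M)
    (n m j t : ℕ) (h : m = 0 ∨ j ≤ t) : stateCount r n false m j t = 0 := by
  refine Finset.sum_eq_zero fun w hw => if_neg ?_
  obtain ⟨y, w, rfl⟩ := List.exists_cons_of_ne_nil (revWords_ne_nil hw)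
  obtain ⟨h1, h2, h3, h4⟩ := revWords_invariants hr n y w hw
  have hM := one_le_maxEntry (y :: w)
  rw [hasState_cons]
  rintro ⟨hy, rfl, rfl, ht⟩
  have := (h4 (by simpa using hy)).1
  omega

theorem walkCount_eq_zero {m j t : ℕ} (h : j ≤ t) : walkCount (m + 1) j t = 0 := by
  simp [walkCount, Nat.sub_eq_zero_of_le h]

theorem stateCount_eq {r : ℕ → ℕ} (hr : ∀ M, 1 ≤ M → 1 ≤ r M ∧ r M ≤ M) (n : ℕ) :
    (∀ m j t, (stateCount r n true m j t : ℚ) = n.choose (m + j) * walkCount m j t) ∧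
      ∀ m j t, (stateCount r n false (m + 1) j t : ℚ) =
        n.choose (m + j) * walkCount (m + 1) j t := by
  induction n with
  | zero =>
    constructor
    · rintro (_ | m) (_ | j) t <;> simp [stateCount_zero, walkCount, ← add_assoc]
    · rintro (_ | m) (_ | j) t <;> simp [stateCount_zero, walkCount, ← add_assoc]
  | succ n ih =>
    obtain ⟨ih1, ih2⟩ := ih
    constructor
    · intro m j t
      rw [stateCount_succ_true hr, Nat.cast_add, ih1]
      rcases m with _ | m
      · rw [stateCount_false_eq_zero hr _ _ _ _ (Or.inl rfl)]
        rcases j with _ | j <;> simp [walkCount]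
      · rw [ih2, show m + 1 + j = m + j + 1 by ring, Nat.choose_succ_succ n (m + j)]
        push_cast
        ring
    · intro m j t
      rcases Nat.lt_or_ge t j with h | h
      · obtain ⟨j, rfl⟩ := Nat.exists_eq_succ_of_ne_zero (show j ≠ 0 by omega)
        rw [stateCount_succ_false hr _ _ _ _ (by omega)]
        push_cast
        have h1 : ∀ s ∈ Finset.range (t + 1),
            (stateCount r n false m (j + 1) s : ℚ) + stateCount r n true m j s =
              n.choose (m + j) * (walkCount m (j + 1) s + walkCount m j s) := by
          intro s _
          rw [ih1, mul_add]
          congr 1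
          rcases m with _ | m
          · rw [stateCount_false_eq_zero hr _ _ _ _ (Or.inl rfl)]
            simp [walkCount]
          · rw [ih2]
            congr 3
            ring
        rw [ih2, Finset.sum_congr rfl h1, ← Finset.mul_sum, ← walkCount_succ m j t (by omega),
          Nat.succ_eq_add_one, show m + (j + 1) = m + j + 1 by ring,
          Nat.choose_succ_succ n (m + j)]
        push_cast
        ring
      · rw [stateCount_false_eq_zero hr _ _ _ _ (Or.inr h), walkCount_eq_zero h]
        simp

theorem card_revWords_filter {r : ℕ → ℕ} (hr : ∀ M, 1 ≤ M → 1 ≤ r M ∧ r M ≤ M) (n m : ℕ)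
    (hm : m ≤ n) :
    (((revWords r n).filter fun w => ascRev w = m).card : ℚ) =
      (n + 1).choose (m + 1) * (n + 1).choose m / (n + 1) := by
  have h : ((revWords r n).filter fun w => ascRev w = m).card =
      ∑ j ∈ Finset.range (m + 1), ∑ t ∈ Finset.range (j + 1),
        (stateCount r n true m j t + stateCount r n false m j t) := by
    simp only [stateCount, ← Finset.sum_add_distrib]
    rw [Finset.card_filter, Finset.sum_congr rfl fun j _ => Finset.sum_comm, Finset.sum_comm]
    refine Finset.sum_congr rfl fun w hw => ?_
    obtain ⟨y, w, rfl⟩ := List.exists_cons_of_ne_nil (revWords_ne_nil hw)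
    obtain ⟨h1, h2, h3, h4⟩ := revWords_invariants hr n y w hw
    simp only [hasState_cons]
    obtain ⟨T, hT⟩ := Nat.exists_eq_add_of_le h2
    generalize maxEntry (y :: w) = M at *
    generalize ascRev (y :: w) = a at *
    generalize zeroAscRev (y :: w) = u at *
    by_cases ha : a = m
    · rw [Finset.sum_eq_single_of_mem u (Finset.mem_range.2 (by omega)),
        Finset.sum_eq_single_of_mem T (Finset.mem_range.2 (by omega))]
      · by_cases hy : y = 0 <;> simp [ha, hy] <;> omega
      · intro t _ ht
        rw [if_neg (by omega), if_neg (by omega), add_zero]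
      · intro j _ hj
        refine Finset.sum_eq_zero fun t _ => ?_
        rw [if_neg (by omega), if_neg (by omega), add_zero]
    · simp [ha]
  rw [h, ← sum_walkCount n m hm]
  push_cast
  refine Finset.sum_congr rfl fun j _ => Finset.sum_congr rfl fun t _ => ?_
  obtain ⟨h1, h2⟩ := stateCount_eq hr n
  rw [h1]
  rcases m with _ | m
  · rw [stateCount_false_eq_zero hr _ _ _ _ (Or.inl rfl)]
    rcases j with _ | j <;> simp [walkCount]
  · rw [h2, show m + 1 + j = m + j + 1 by ring, Nat.choose_succ_succ n (m + j)]
    push_cast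
    ring

theorem numAscents_cons_cons (a b : ℕ) (w : List ℕ) :
    numAscents (a :: b :: w) = numAscents (b :: w) + if a < b then 1 else 0 := by
  simp [numAscents, List.countP_cons]

theorem numAscents_append_pair (v : List ℕ) (y x : ℕ) :
    numAscents (v ++ [y, x]) = numAscents (v ++ [y]) + if y < x then 1 else 0 := by
  induction v with
  | nil => simp [numAscents]
  | cons a v ih =>
    rcases v with _ | ⟨b, v⟩
    · simp only [List.cons_append, List.nil_append, numAscents_cons_cons]
      simp [numAscents, add_comm]
    · simp only [List.cons_append, numAscents_cons_cons] at ih ⊢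
      omega

theorem numAscents_reverse (w : List ℕ) : numAscents w.reverse = ascRev w := by
  induction w with
  | nil => simp [numAscents, ascRev]
  | cons x w ih =>
    rcases w with _ | ⟨y, w⟩
    · simp [numAscents, ascRev]
    · rw [ascRev, ← ih]
      simp [numAscents_append_pair]

theorem isAscentSeq_append_singleton {v : List ℕ} (hv : v ≠ []) (x : ℕ) :
    IsAscentSeq (v ++ [x]) ↔ IsAscentSeq v ∧ x ≤ numAscents v + 1 := by
  have hlen := List.length_pos_iff.2 hv
  simp only [IsAscentSeq, List.head?_append_of_ne_nil _ hv, and_assoc, List.get_eq_getElem,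
    List.length_append, List.length_singleton]
  refine and_congr_right fun _ => ⟨fun h => ⟨fun i hi h1 => ?_, ?_⟩, fun ⟨h, hx⟩ i hi h1 => ?_⟩
  · have := h i (by omega) h1
    rwa [List.getElem_append_left hi, List.take_append_of_le_length hi.le] at this
  · have := h v.length (by omega) hlen
    simpa using this
  · rcases Nat.lt_or_ge i v.length with hi' | hi'
    · rw [List.getElem_append_left hi', List.take_append_of_le_length hi'.le]
      exact h i hi' h1
    · obtain rfl : i = v.length := by omega
      simpa using hx

theorem isAscentSeq_singleton (x : ℕ) : IsAscentSeq [x] ↔ x = 0 := by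
  simp only [IsAscentSeq, List.head?_cons, Option.some.injEq, List.length_singleton,
    and_iff_left_iff_imp]
  omega

theorem maxEntry_le_iff {w : List ℕ} {x : ℕ} : maxEntry w ≤ x ↔ 1 ≤ x ∧ ∀ a ∈ w, a ≤ x := by
  induction w with
  | nil => simp [maxEntry]
  | cons y w ih => simp [maxEntry, ih]; tauto

theorem maxEntry_lt_iff {w : List ℕ} {x : ℕ} : maxEntry w < x ↔ 1 < x ∧ ∀ a ∈ w, a < x := by
  induction w with
  | nil => simp [maxEntry]
  | cons y w ih => simp [maxEntry, ih]; tauto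

theorem mem_revWords_iff {r : ℕ → ℕ} (hr : ∀ M, 1 ≤ M → 1 ≤ r M ∧ r M ≤ M) (R : ℕ → ℕ → Prop)
    (hR : ∀ w x, maxEntry w ≤ ascRev w + 1 →
      (x ∈ nextLetters r w ↔ x ≤ ascRev w + 1 ∧ ∀ a ∈ w, R a x)) (n : ℕ) (w : List ℕ) :
    w ∈ revWords r n ↔ w.length = n + 1 ∧ IsAscentSeq w.reverse ∧ w.reverse.Pairwise R := by
  induction n generalizing w with
  | zero =>
    simp only [revWords, Finset.mem_singleton, zero_add, List.length_eq_one_iff]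
    constructor
    · rintro rfl
      simp [isAscentSeq_singleton]
    · rintro ⟨⟨a, rfl⟩, h, _⟩
      simpa [isAscentSeq_singleton] using h
  | succ n ih =>
    simp only [revWords, Finset.mem_biUnion, Finset.mem_image]
    rcases w with _ | ⟨x, w⟩
    · simp
    rcases w with _ | ⟨y, w⟩
    · simp only [List.length_singleton, List.cons.injEq, Nat.right_eq_add, Nat.add_eq_zero_iff]
      constructor
      · rintro ⟨v, hv, _, _, _, h⟩
        exact absurd h (revWords_ne_nil hv)
      · intro h
        omega
    · have key : (∃ v ∈ revWords r n, ∃ z ∈ nextLetters r v, z :: v = x :: y :: w) ↔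
          y :: w ∈ revWords r n ∧ x ∈ nextLetters r (y :: w) := by
        constructor
        · rintro ⟨v, hv, z, hz, h⟩
          obtain ⟨rfl, rfl⟩ := List.cons.inj h
          exact ⟨hv, hz⟩
        · rintro ⟨hv, hz⟩
          exact ⟨_, hv, _, hz, rfl⟩
      have hx : y :: w ∈ revWords r n → (x ∈ nextLetters r (y :: w) ↔
          x ≤ ascRev (y :: w) + 1 ∧ ∀ a ∈ y :: w, R a x) :=
        fun h => hR _ _ (revWords_invariants hr n y w h).1
      rw [key, and_congr_right hx, ih, List.reverse_cons (a := x),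
        isAscentSeq_append_singleton (by simp), numAscents_reverse, List.pairwise_append]
      have hlast : (∀ a ∈ (y :: w).reverse, ∀ b ∈ [x], R a b) ↔ ∀ a ∈ y :: w, R a x := by
        simp only [List.mem_reverse, List.mem_singleton, forall_eq]
      rw [hlast]
      simp only [List.length_cons, add_left_inj, List.pairwise_singleton, true_and]
      tauto

theorem mem_revWords_id (n : ℕ) (w : List ℕ) :
    w ∈ revWords id n ↔ w.length = n + 1 ∧ IsAscentSeq w.reverse ∧
      w.reverse.Pairwise fun a b => b = 0 ∨ a ≤ b := by
  refine mem_revWords_iff (fun M hM => ⟨hM, le_rfl⟩) _ (fun w x h => ?_) n w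
  simp only [nextLetters, Finset.mem_insert, Finset.mem_Ioc]
  have h1 := maxEntry_le_iff (w := w) (x := x)
  rcases Nat.eq_zero_or_pos x with rfl | hx
  · simp
  · have : (∀ a ∈ w, x = 0 ∨ a ≤ x) ↔ maxEntry w ≤ x := by
      rw [h1]
      simp [hx.ne']
      omega
    rw [this]
    omega

theorem mem_revWords_one (n : ℕ) (w : List ℕ) :
    w ∈ revWords (fun _ => 1) n ↔ w.length = n + 1 ∧ IsAscentSeq w.reverse ∧
      w.reverse.Pairwise fun a b => b ≤ 1 ∨ a < b := by
  refine mem_revWords_iff (fun M hM => ⟨le_rfl, hM⟩) _ (fun w x h => ?_) n w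
  simp only [nextLetters, Finset.mem_insert, Finset.mem_Ioc]
  have h1 := maxEntry_lt_iff (w := w) (x := x)
  have h2 := one_le_maxEntry w
  rcases Nat.lt_or_ge 1 x with hx | hx
  · have : (∀ a ∈ w, x ≤ 1 ∨ a < x) ↔ maxEntry w < x := by
      rw [h1]
      simp [hx, hx.not_ge]
    rw [this]
    omega
  · simp [hx]
    omega

theorem ncard_eq_narayana {r : ℕ → ℕ} (hr : ∀ M, 1 ≤ M → 1 ≤ r M ∧ r M ≤ M) (R : ℕ → ℕ → Prop)
    {n m : ℕ} (hm : m ≤ n) (h : ∀ w, w ∈ revWords r n ↔ w.length = n + 1 ∧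
      IsAscentSeq w.reverse ∧ w.reverse.Pairwise R) :
    {w : List ℕ | w.length = n + 1 ∧ IsAscentSeq w ∧ numAscents w = m ∧ w.Pairwise R}.ncard =
      narayana (n + 1) (m + 1) := by
  have h1 : {w : List ℕ | w.length = n + 1 ∧ IsAscentSeq w ∧ numAscents w = m ∧ w.Pairwise R} =
      List.reverse '' ((revWords r n).filter fun w => ascRev w = m : Finset (List ℕ)) := by
    ext w
    simp only [Set.mem_ofPred_eq, Set.mem_image, Finset.coe_filter, h, ← numAscents_reverse]
    constructor
    · rintro ⟨h1, h2, h3, h4⟩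
      exact ⟨w.reverse, by simp_all, by simp⟩
    · rintro ⟨v, ⟨⟨h1, h2, h4⟩, h3⟩, rfl⟩
      exact ⟨by simpa, h2, h3, h4⟩
  rw [h1, Set.ncard_image_of_injective _ List.reverse_injective, Set.ncard_coe_finset, narayana]
  have h2 := card_revWords_filter hr n m hm
  field_simp at h2
  refine (Nat.div_eq_of_eq_mul_left n.succ_pos ?_).symm
  exact_mod_cast h2.symm

theorem contains_four_iff (w : List ℕ) (a b c d : ℕ) :
    Contains w [a, b, c, d] ↔ ∃ i j k l, i < j ∧ j < k ∧ k < l ∧ l < w.length ∧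
      ((w.getD i 0 < w.getD j 0 ↔ a < b) ∧ (w.getD j 0 < w.getD i 0 ↔ b < a)) ∧
      ((w.getD i 0 < w.getD k 0 ↔ a < c) ∧ (w.getD k 0 < w.getD i 0 ↔ c < a)) ∧
      ((w.getD i 0 < w.getD l 0 ↔ a < d) ∧ (w.getD l 0 < w.getD i 0 ↔ d < a)) ∧
      ((w.getD j 0 < w.getD k 0 ↔ b < c) ∧ (w.getD k 0 < w.getD j 0 ↔ c < b)) ∧
      ((w.getD j 0 < w.getD l 0 ↔ b < d) ∧ (w.getD l 0 < w.getD j 0 ↔ d < b)) ∧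
      ((w.getD k 0 < w.getD l 0 ↔ c < d) ∧ (w.getD l 0 < w.getD k 0 ↔ d < c)) := by
  have hget : ∀ i : Fin w.length, w.get i = w.getD i 0 := fun i => by
    simp
  simp only [Contains, hget]
  constructor
  · rintro ⟨f, hf, h⟩
    refine ⟨f (0 : Fin 4), f (1 : Fin 4), f (2 : Fin 4), f (3 : Fin 4), ?_, ?_, ?_, ?_,
      h (0 : Fin 4) (1 : Fin 4), h (0 : Fin 4) (2 : Fin 4), h (0 : Fin 4) (3 : Fin 4),
      h (1 : Fin 4) (2 : Fin 4), h (1 : Fin 4) (3 : Fin 4), h (2 : Fin 4) (3 : Fin 4)⟩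
    · exact hf (show (0 : Fin 4) < 1 by decide)
    · exact hf (show (1 : Fin 4) < 2 by decide)
    · exact hf (show (2 : Fin 4) < 3 by decide)
    · exact (f _).2
  · rintro ⟨i, j, k, l, hij, hjk, hkl, hl, h⟩
    let f : Fin 4 → Fin w.length :=
      ![⟨i, by omega⟩, ⟨j, by omega⟩, ⟨k, by omega⟩, ⟨l, hl⟩]
    refine ⟨f, ?_, ?_⟩
    · refine Fin.strictMono_iff_lt_succ (n := 3).2 fun s => ?_
      fin_cases s
      · exact hij
      · exact hjk
      · exact hkl
    · intro s t
      change Fin 4 at s t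
      fin_cases s <;> fin_cases t <;> simp [f] <;> simp at h <;> grind

theorem numAscents_take_succ {w : List ℕ} {i : ℕ} (hi : i + 1 < w.length) :
    numAscents (w.take (i + 2)) =
      numAscents (w.take (i + 1)) + if w.getD i 0 < w.getD (i + 1) 0 then 1 else 0 := by
  rw [List.take_succ_eq_append_getElem hi, List.take_succ_eq_append_getElem (i := i) (by omega),
    List.append_assoc, List.singleton_append, numAscents_append_pair]
  simp [List.getElem?_eq_getElem hi, List.getElem?_eq_getElem (show i < w.length by omega)]

theorem numAscents_take_le {w : List ℕ} {i : ℕ} (hi : i < w.length) :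
    numAscents (w.take (i + 1)) ≤ i := by
  induction i with
  | zero =>
    rw [List.take_succ_eq_append_getElem hi]
    simp [numAscents]
  | succ i ih =>
    rw [numAscents_take_succ hi]
    have := ih (by omega)
    split_ifs <;> omega

theorem numAscents_take_le_getD {w : List ℕ} {i : ℕ} (hi : i < w.length)
    (h : ∀ s t, s < t → t ≤ i → w.getD s 0 ≤ w.getD t 0) :
    numAscents (w.take (i + 1)) ≤ w.getD i 0 := by
  induction i with
  | zero => exact (numAscents_take_le hi).trans (Nat.zero_le _)
  | succ i ih =>
    rw [numAscents_take_succ hi]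
    have h1 := ih (by omega) fun s t hs ht => h s t hs (by omega)
    have h2 := h i (i + 1) (by omega) le_rfl
    split_ifs <;> omega

theorem IsAscentSeq.getD_zero {w : List ℕ} (hw : IsAscentSeq w) : w.getD 0 0 = 0 := by
  have := hw.1
  rcases w with _ | ⟨a, w⟩ <;> simp_all

theorem IsAscentSeq.getD_succ_le {w : List ℕ} (hw : IsAscentSeq w) {i : ℕ}
    (hi : i + 1 < w.length) : w.getD (i + 1) 0 ≤ numAscents (w.take (i + 1)) + 1 := by
  have := hw.2 (i + 1) hi (by omega)
  simpa [List.getElem?_eq_getElem hi] using this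

theorem IsAscentSeq.exists_getD_eq_one {w : List ℕ} (hw : IsAscentSeq w) {i : ℕ}
    (hi : i < w.length) (h : 2 ≤ w.getD i 0) : ∃ q, 0 < q ∧ q < i ∧ w.getD q 0 = 1 := by
  have hex : ∃ q, w.getD q 0 ≠ 0 := ⟨i, by omega⟩
  obtain ⟨q, hq, hmin⟩ : ∃ q, w.getD q 0 ≠ 0 ∧ ∀ s < q, w.getD s 0 = 0 :=
    ⟨Nat.find hex, Nat.find_spec hex, fun s hs => not_not.1 (Nat.find_min hex hs)⟩
  have hqi : q ≤ i := by
    by_contra hlt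
    have := hmin i (by omega)
    omega
  rcases q with _ | q
  · exact absurd hw.getD_zero hq
  have h1 := hw.getD_succ_le (i := q) (by omega)
  have h2 : numAscents (w.take (q + 1)) ≤ w.getD q 0 :=
    numAscents_take_le_getD (by omega) fun s t hst ht => by
      rw [hmin s (by omega), hmin t (by omega)]
  have h3 := hmin q (by omega)
  have h4 : q + 1 ≠ i := by
    rintro rfl
    omega
  exact ⟨q + 1, by omega, by omega, by omega⟩

theorem IsAscentSeq.exists_descent {w : List ℕ} (hw : IsAscentSeq w) {p b : ℕ}
    (hp : p < w.length) (h : b < w.getD p 0) (hlt : ∀ q < p, w.getD q 0 < b) :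
    ∃ s t, s < t ∧ t < p ∧ w.getD t 0 < w.getD s 0 := by
  by_contra! hmono
  rcases p with _ | p
  · have := hw.getD_zero
    omega
  have h1 := hw.getD_succ_le hp
  have h2 := numAscents_take_le_getD (i := p) (by omega) fun s t hst ht =>
    hmono s t hst (by omega)
  have h3 := hlt p (by omega)
  omega

theorem IsAscentSeq.exists_repetition {w : List ℕ} (hw : IsAscentSeq w) {p b : ℕ}
    (hp : p < w.length) (h : b < w.getD p 0) (hlt : ∀ q < p, w.getD q 0 < b) :
    ∃ s t, s < t ∧ t < p ∧ w.getD s 0 = w.getD t 0 := by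
  have hbp : b < p := by
    rcases p with _ | p
    · have := hw.getD_zero
      omega
    have h1 := hw.getD_succ_le hp
    have h2 := numAscents_take_le (w := w) (i := p) (by omega)
    omega
  obtain ⟨s, hs, t, ht, hst, heq⟩ := Finset.exists_ne_map_eq_of_card_lt_of_maps_to
    (s := Finset.range p) (t := Finset.range b) (by simpa using hbp)
    (f := fun q => w.getD q 0) (fun q hq => by simpa using hlt q (by simpa using hq))
  rw [Finset.mem_range] at hs ht
  rcases Nat.lt_or_gt_of_ne hst with hlt | hlt
  · exact ⟨s, t, hlt, ht, heq⟩
  · exact ⟨t, s, hlt, hs, heq.symm⟩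

theorem exists_first_gt {w : List ℕ} {i b : ℕ} (h : b < w.getD i 0) :
    ∃ p ≤ i, b < w.getD p 0 ∧ ∀ q < p, w.getD q 0 ≤ b := by
  have hex : ∃ p, b < w.getD p 0 := ⟨i, h⟩
  exact ⟨Nat.find hex, Nat.find_min' hex h, Nat.find_spec hex,
    fun q hq => not_lt.1 (Nat.find_min hex hq)⟩

theorem pairwise_iff_getD {w : List ℕ} {R : ℕ → ℕ → Prop} :
    w.Pairwise R ↔ ∀ i j, i < j → j < w.length → R (w.getD i 0) (w.getD j 0) := by
  rw [List.pairwise_iff_getElem]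
  constructor
  · intro h i j hij hj
    simpa [List.getElem?_eq_getElem hj, List.getElem?_eq_getElem (hij.trans hj)] using
      h i j (hij.trans hj) hj hij
  · intro h i j hi hj hij
    simpa [List.getElem?_eq_getElem hj, List.getElem?_eq_getElem hi] using h i j hij hj

theorem avoids_of_pairwise_le {w : List ℕ} (h : w.Pairwise fun a b => b = 0 ∨ a ≤ b) :
    Avoids w [0, 0, 2, 1] ∧ Avoids w [0, 1, 2, 1] ∧ Avoids w [0, 1, 3, 2] ∧
      Avoids w [1, 0, 3, 2] := by
  rw [pairwise_iff_getD] at h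
  simp only [Avoids, contains_four_iff]
  refine ⟨?_, ?_, ?_, ?_⟩ <;>
  · rintro ⟨i, j, k, l, hij, hjk, hkl, hl, h'⟩
    have := h k l hkl hl
    omega

theorem avoids_of_pairwise_lt {w : List ℕ} (h : w.Pairwise fun a b => b ≤ 1 ∨ a < b) :
    Avoids w [0, 1, 2, 2] ∧ Avoids w [0, 1, 3, 2] ∧ Avoids w [1, 0, 3, 2] := by
  rw [pairwise_iff_getD] at h
  simp only [Avoids, contains_four_iff]
  refine ⟨?_, ?_, ?_⟩ <;>
  · rintro ⟨i, j, k, l, hij, hjk, hkl, hl, h'⟩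
    have := h k l hkl hl
    omega

/-- In an ascent sequence avoiding `0121`, a letter exceeding a later nonzero letter `b` is
preceded by, or equal to, one exceeding `b` before which all letters are smaller than `b`. -/
theorem IsAscentSeq.exists_first_gt_of_avoids {w : List ℕ} (hw : IsAscentSeq w)
    (h : Avoids w [0, 1, 2, 1]) {i j : ℕ} (hij : i < j) (hj : j < w.length)
    (hj0 : w.getD j 0 ≠ 0) (hlt : w.getD j 0 < w.getD i 0) :
    ∃ p ≤ i, w.getD j 0 < w.getD p 0 ∧ ∀ q < p, w.getD q 0 < w.getD j 0 := by
  obtain ⟨p, hpi, hp, hmin⟩ := exists_first_gt hlt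
  refine ⟨p, hpi, hp, fun q hq => lt_of_le_of_ne (hmin q hq) fun heq => h ?_⟩
  have h0 := hw.getD_zero
  have hq0 : 0 < q := Nat.pos_of_ne_zero fun hq0 => by
    subst hq0
    omega
  rw [contains_four_iff]
  exact ⟨0, q, p, j, hq0, hq, by omega, hj, by omega⟩

theorem IsAscentSeq.avoids_0021_0121_iff {w : List ℕ} (hw : IsAscentSeq w) :
    Avoids w [0, 0, 2, 1] ∧ Avoids w [0, 1, 2, 1] ↔ w.Pairwise fun a b => b = 0 ∨ a ≤ b := by
  refine ⟨fun ⟨h1, h2⟩ => ?_, fun h => ⟨(avoids_of_pairwise_le h).1, (avoids_of_pairwise_le h).2.1⟩⟩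
  rw [pairwise_iff_getD]
  intro i j hij hj
  by_contra! hcon
  obtain ⟨p, hpi, hp, hmin⟩ := hw.exists_first_gt_of_avoids h2 hij hj hcon.1 hcon.2
  obtain ⟨s, t, hst, htp, heq⟩ := hw.exists_repetition (by omega) hp hmin
  have := hmin s (by omega)
  refine h1 ((contains_four_iff _ _ _ _ _).2 ⟨s, t, p, j, hst, htp, by omega, hj, ?_⟩)
  omega

theorem IsAscentSeq.avoids_0121_0132_iff {w : List ℕ} (hw : IsAscentSeq w) :
    Avoids w [0, 1, 2, 1] ∧ Avoids w [0, 1, 3, 2] ↔ w.Pairwise fun a b => b = 0 ∨ a ≤ b := by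
  refine ⟨fun ⟨h1, h2⟩ => ?_,
    fun h => ⟨(avoids_of_pairwise_le h).2.1, (avoids_of_pairwise_le h).2.2.1⟩⟩
  rw [pairwise_iff_getD]
  intro i j hij hj
  by_contra! hcon
  obtain ⟨q, hq0, hqi, hq⟩ := hw.exists_getD_eq_one (i := i) (by omega) (by omega)
  have h0 := hw.getD_zero
  rcases Nat.lt_or_ge 1 (w.getD j 0) with h | h
  · refine h2 ((contains_four_iff _ _ _ _ _).2 ⟨0, q, i, j, hq0, hqi, hij, hj, ?_⟩)
    omega
  · refine h1 ((contains_four_iff _ _ _ _ _).2 ⟨0, q, i, j, hq0, hqi, hij, hj, ?_⟩)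
    omega

theorem IsAscentSeq.avoids_0121_1032_iff {w : List ℕ} (hw : IsAscentSeq w) :
    Avoids w [0, 1, 2, 1] ∧ Avoids w [1, 0, 3, 2] ↔ w.Pairwise fun a b => b = 0 ∨ a ≤ b := by
  refine ⟨fun ⟨h1, h2⟩ => ?_,
    fun h => ⟨(avoids_of_pairwise_le h).2.1, (avoids_of_pairwise_le h).2.2.2⟩⟩
  rw [pairwise_iff_getD]
  intro i j hij hj
  by_contra! hcon
  obtain ⟨p, hpi, hp, hmin⟩ := hw.exists_first_gt_of_avoids h1 hij hj hcon.1 hcon.2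
  obtain ⟨s, t, hst, htp, hdesc⟩ := hw.exists_descent (by omega) hp hmin
  have := hmin s (by omega)
  refine h2 ((contains_four_iff _ _ _ _ _).2 ⟨s, t, p, j, hst, htp, by omega, hj, ?_⟩)
  omega

theorem IsAscentSeq.getD_ne_of_avoids_0122 {w : List ℕ} (hw : IsAscentSeq w)
    (h : Avoids w [0, 1, 2, 2]) {i j : ℕ} (hij : i < j) (hj : j < w.length)
    (hj2 : 2 ≤ w.getD j 0) : w.getD i 0 ≠ w.getD j 0 := by
  intro heq
  obtain ⟨q, hq0, hqi, hq⟩ := hw.exists_getD_eq_one (i := i) (by omega) (by omega)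
  have h0 := hw.getD_zero
  refine h ((contains_four_iff _ _ _ _ _).2 ⟨0, q, i, j, hq0, hqi, hij, hj, ?_⟩)
  omega

theorem IsAscentSeq.avoids_0122_0132_iff {w : List ℕ} (hw : IsAscentSeq w) :
    Avoids w [0, 1, 2, 2] ∧ Avoids w [0, 1, 3, 2] ↔ w.Pairwise fun a b => b ≤ 1 ∨ a < b := by
  refine ⟨fun ⟨h1, h2⟩ => ?_,
    fun h => ⟨(avoids_of_pairwise_lt h).1, (avoids_of_pairwise_lt h).2.1⟩⟩
  rw [pairwise_iff_getD]
  intro i j hij hj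
  by_contra! hcon
  obtain ⟨q, hq0, hqi, hq⟩ := hw.exists_getD_eq_one (i := i) (by omega) (by omega)
  have h0 := hw.getD_zero
  have hne := hw.getD_ne_of_avoids_0122 h1 hij hj (by omega)
  refine h2 ((contains_four_iff _ _ _ _ _).2 ⟨0, q, i, j, hq0, hqi, hij, hj, ?_⟩)
  omega

theorem IsAscentSeq.avoids_0122_1032_iff {w : List ℕ} (hw : IsAscentSeq w) :
    Avoids w [0, 1, 2, 2] ∧ Avoids w [1, 0, 3, 2] ↔ w.Pairwise fun a b => b ≤ 1 ∨ a < b := by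
  refine ⟨fun ⟨h1, h2⟩ => ?_,
    fun h => ⟨(avoids_of_pairwise_lt h).1, (avoids_of_pairwise_lt h).2.2⟩⟩
  rw [pairwise_iff_getD]
  intro i j hij hj
  by_contra! hcon
  have hne := hw.getD_ne_of_avoids_0122 h1 hij hj (by omega)
  obtain ⟨p, hpi, hp, hle⟩ := exists_first_gt (show w.getD j 0 < w.getD i 0 by omega)
  have hmin : ∀ q < p, w.getD q 0 < w.getD j 0 := fun q hq =>
    lt_of_le_of_ne (hle q hq) (hw.getD_ne_of_avoids_0122 h1 (by omega) hj (by omega))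
  obtain ⟨s, t, hst, htp, hdesc⟩ := hw.exists_descent (by omega) hp hmin
  have := hmin s (by omega)
  refine h2 ((contains_four_iff _ _ _ _ _).2 ⟨s, t, p, j, hst, htp, by omega, hj, ?_⟩)
  omega

theorem avoiderCountAsc_pair_eq {u v : List ℕ} {R : ℕ → ℕ → Prop} (n m : ℕ)
    (h : ∀ w, IsAscentSeq w → (Avoids w u ∧ Avoids w v ↔ w.Pairwise R)) :
    avoiderCountAsc n m [u, v] =
      {w : List ℕ | w.length = n ∧ IsAscentSeq w ∧ numAscents w = m ∧ w.Pairwise R}.ncard := by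
  rw [avoiderCountAsc]
  congr 1
  ext w
  simp only [Set.mem_ofPred_eq, List.mem_cons, List.not_mem_nil, or_false, forall_eq_or_imp,
    forall_eq]
  have := h w
  tauto

/-- For each of the five pattern pairs, the number of ascent sequences of length `n`
with exactly `m` ascents avoiding both patterns equals the Narayana number `N_{n,m+1}`. -/
theorem narayana_count_five_pairs (n m : ℕ) (hn : 1 ≤ n) (hm : m < n) :
    avoiderCountAsc n m [[0,0,2,1], [0,1,2,1]] = narayana n (m + 1) ∧
    avoiderCountAsc n m [[0,1,2,1], [0,1,3,2]] = narayana n (m + 1) ∧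
    avoiderCountAsc n m [[0,1,2,1], [1,0,3,2]] = narayana n (m + 1) ∧
    avoiderCountAsc n m [[0,1,2,2], [0,1,3,2]] = narayana n (m + 1) ∧
    avoiderCountAsc n m [[0,1,2,2], [1,0,3,2]] = narayana n (m + 1) := by
  obtain ⟨n, rfl⟩ := Nat.exists_eq_add_of_le' hn
  have hle := ncard_eq_narayana (r := id) (fun M hM => ⟨hM, le_rfl⟩) _ (Nat.le_of_lt_succ hm)
    (mem_revWords_id n)
  have hlt := ncard_eq_narayana (r := fun _ => 1) (fun M hM => ⟨le_rfl, hM⟩) _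
    (Nat.le_of_lt_succ hm) (mem_revWords_one n)
  exact ⟨(avoiderCountAsc_pair_eq _ _ fun _ hw => hw.avoids_0021_0121_iff).trans hle,
    (avoiderCountAsc_pair_eq _ _ fun _ hw => hw.avoids_0121_0132_iff).trans hle,
    (avoiderCountAsc_pair_eq _ _ fun _ hw => hw.avoids_0121_1032_iff).trans hle,
    (avoiderCountAsc_pair_eq _ _ fun _ hw => hw.avoids_0122_0132_iff).trans hlt,
    (avoiderCountAsc_pair_eq _ _ fun _ hw => hw.avoids_0122_1032_iff).trans hlt⟩
end

section
/- For every integer n ≥ 1, an ascent sequence of length n avoids both of the patterns 0021 and 0121 if and only if it avoids the pattern 021; that is, 𝒮_n(0021,0121) = 𝒮_n(021) as sets. -/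
/-- The set of ascent sequences of length `n` avoiding every pattern in `T`. -/
def avoiderSet (n : ℕ) (T : List (List ℕ)) : Set (List ℕ) :=
  {w : List ℕ | w.length = n ∧ IsAscentSeq w ∧ ∀ τ ∈ T, Avoids w τ}

theorem numAscents_le_length_sub_one (w : List ℕ) : numAscents w ≤ w.length - 1 := by
  refine List.countP_le_length.trans ?_
  simp

theorem Contains.trans {π σ τ : List ℕ} (h₁ : Contains π σ) (h₂ : Contains σ τ) :
    Contains π τ := by
  obtain ⟨f, hf, hf'⟩ := h₁
  obtain ⟨g, hg, hg'⟩ := h₂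
  exact ⟨f ∘ g, hf.comp hg, fun i j =>
    ⟨(hf' _ _).1.trans (hg' i j).1, (hf' _ _).2.trans (hg' i j).2⟩⟩

theorem contains_0021_021 : Contains [0, 0, 2, 1] [0, 2, 1] :=
  ⟨(![1, 2, 3] : Fin 3 → Fin 4), by unfold StrictMono; decide, by decide⟩

theorem contains_0121_021 : Contains [0, 1, 2, 1] [0, 2, 1] :=
  ⟨(![0, 2, 3] : Fin 3 → Fin 4), by unfold StrictMono; decide, by decide⟩

theorem contains_0021_of_lt {w : List ℕ} {i j k l : Fin w.length} (hij : i < j) (hjk : j < k)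
    (hkl : k < l) (h₁ : w.get i = w.get j) (h₂ : w.get j < w.get l) (h₃ : w.get l < w.get k) :
    Contains w [0, 0, 2, 1] := by
  refine ⟨(![i, j, k, l] : Fin 4 → Fin w.length), ?_, ?_⟩
  · exact Fin.strictMono_iff_lt_succ.2 (by simp [Fin.forall_fin_succ, hij, hjk, hkl])
  · change ∀ a b : Fin 4, _
    simp only [Fin.forall_fin_succ]
    simp at h₁ h₂ h₃ ⊢
    omega

theorem contains_0121_of_lt {w : List ℕ} {i j k l : Fin w.length} (hij : i < j) (hjk : j < k)
    (hkl : k < l) (h₁ : w.get i < w.get j) (h₂ : w.get j = w.get l) (h₃ : w.get l < w.get k) :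
    Contains w [0, 1, 2, 1] := by
  refine ⟨(![i, j, k, l] : Fin 4 → Fin w.length), ?_, ?_⟩
  · exact Fin.strictMono_iff_lt_succ.2 (by simp [Fin.forall_fin_succ, hij, hjk, hkl])
  · change ∀ a b : Fin 4, _
    simp only [Fin.forall_fin_succ]
    simp at h₁ h₂ h₃ ⊢
    omega

theorem IsAscentSeq.get_le {w : List ℕ} (hw : IsAscentSeq w) (i : Fin w.length) :
    w.get i ≤ i := by
  obtain ⟨i, hi⟩ := i
  rcases Nat.eq_zero_or_pos i with rfl | hpos
  · have h := hw.1
    rw [List.head?_eq_getElem?, List.getElem?_eq_getElem hi] at h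
    simpa using h
  · have h₁ := hw.2 i hi hpos
    have h₂ := numAscents_le_length_sub_one (w.take i)
    rw [List.length_take] at h₂
    change w.get ⟨i, hi⟩ ≤ i
    omega

/-- An ascent sequence containing 021 contains 0021 or 0121. Let `y` be the value playing the
role of 1. If `y` does not occur before the first entry larger than `y`, then that entry exceeds
its index bound unless two of the entries before it, all smaller than `y`, agree. -/
theorem IsAscentSeq.contains_0021_or_0121 {w : List ℕ} (hw : IsAscentSeq w)
    (h : Contains w [0, 2, 1]) : Contains w [0, 0, 2, 1] ∨ Contains w [0, 1, 2, 1] := by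
  obtain ⟨f, hf, hf'⟩ := h
  change Fin 3 → Fin w.length at f
  have hac : w.get (f 0) < w.get (f 2) := (hf' (0 : Fin 3) (2 : Fin 3)).1.2 (by decide)
  have hcb : w.get (f 2) < w.get (f 1) := (hf' (2 : Fin 3) (1 : Fin 3)).1.2 (by decide)
  have hbc : f 1 < f 2 := hf (show (1 : Fin 3) < 2 by decide)
  obtain ⟨p, hp, hmin⟩ :=
    exists_minimal_of_wellFoundedLT (fun i => w.get (f 2) < w.get i) ⟨f 1, hcb⟩
  have hpb : p ≤ f 1 := by
    by_contra! hlt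
    exact hlt.not_ge (hmin hcb hlt.le)
  have hpc : p < f 2 := hpb.trans_lt hbc
  have hle : ∀ i < p, w.get i ≤ w.get (f 2) := by
    intro i hi
    by_contra! hlt
    exact hi.not_ge (hmin hlt hi.le)
  by_cases hy : ∃ i < p, w.get i = w.get (f 2)
  · obtain ⟨i, hip, hi⟩ := hy
    have h₀ := hw.get_le ⟨0, i.pos⟩
    have hlt : w.get ⟨0, i.pos⟩ < w.get i := by
      change _ ≤ 0 at h₀
      omega
    have h0i : (⟨0, i.pos⟩ : Fin w.length) < i := by
      refine lt_of_le_of_ne (Nat.zero_le _) ?_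
      intro he
      rw [← he] at hlt
      exact hlt.false
    exact .inr (contains_0121_of_lt h0i hip hpc hlt hi hp)
  · push Not at hy
    have hlt : ∀ i < p, w.get i < w.get (f 2) := fun i hi => lt_of_le_of_ne (hle i hi) (hy i hi)
    have hcard : (Finset.range (w.get (f 2))).card < (Finset.Iio p).card := by
      rw [Finset.card_range, Fin.card_Iio]
      exact hp.trans_le (hw.get_le p)
    obtain ⟨i, hi, j, hj, hne, he⟩ := Finset.exists_ne_map_eq_of_card_lt_of_maps_to hcard
      (f := w.get) (fun i hi => by simpa using hlt i (by simpa using hi))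
    rw [Finset.mem_Iio] at hi hj
    rcases hne.lt_or_gt with hij | hji
    · exact .inl (contains_0021_of_lt hij hj hpc he (hlt j hj) hp)
    · exact .inl (contains_0021_of_lt hji hi hpc he.symm (hlt i hi) hp)

/-- An ascent sequence of length `n` avoids both 0021 and 0121 iff it avoids 021. -/
theorem avoiderSet_0021_0121_eq_021 (n : ℕ) (hn : 1 ≤ n) :
    avoiderSet n [[0,0,2,1], [0,1,2,1]] = avoiderSet n [[0,2,1]] := by
  ext w
  simp only [avoiderSet, Set.mem_ofPred_eq, List.forall_mem_cons, List.not_mem_nil,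
    false_implies, implies_true, and_true]
  refine and_congr_right fun _ => and_congr_right fun hw => ?_
  constructor
  · rintro ⟨h₁, h₂⟩ h
    exact (hw.contains_0021_or_0121 h).elim h₁ h₂
  · intro h
    exact ⟨fun h' => h (h'.trans contains_0021_021), fun h' => h (h'.trans contains_0121_021)⟩
end

section
/- For every integer n ≥ 1, an ascent sequence of length n avoiding the pattern 0121 avoids the pattern 0132 if and only if it avoids the pattern 1032; that is, 𝒮_n(0121,0132) = 𝒮_n(0121,1032) = 𝒮_n(0121,0132,1032) as sets. -/
lemma contains_four {π : List ℕ} {p q r s : ℕ} {i j k l : Fin π.length}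
    (hij : i < j) (hjk : j < k) (hkl : k < l)
    (h : ∀ u v : Fin 4, ![π.get i, π.get j, π.get k, π.get l] u <
      ![π.get i, π.get j, π.get k, π.get l] v ↔ ![p, q, r, s] u < ![p, q, r, s] v) :
    Contains π [p, q, r, s] := by
  have hget : ∀ u : Fin 4, π.get ((![i, j, k, l] : Fin 4 → Fin π.length) u) =
      ![π.get i, π.get j, π.get k, π.get l] u := by
    intro u; fin_cases u <;> rfl
  have hpat : ∀ u : Fin 4, [p, q, r, s].get u = ![p, q, r, s] u := by
    intro u; fin_cases u <;> rfl
  refine ⟨(![i, j, k, l] : Fin 4 → Fin π.length), ?_, fun (u v : Fin 4) => ?_⟩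
  · refine Fin.strictMono_iff_lt_succ (n := 3).2 fun u => ?_
    fin_cases u <;> assumption
  · rw [hget, hget, hpat, hpat]
    exact ⟨h u v, h v u⟩

lemma contains_0121_of {π : List ℕ} {i j k l : Fin π.length}
    (hij : i < j) (hjk : j < k) (hkl : k < l)
    (h₁ : π.get i < π.get j) (h₂ : π.get j < π.get k) (h₃ : π.get l = π.get j) :
    Contains π [0, 1, 2, 1] := by
  refine contains_four hij hjk hkl fun u v => ?_
  fin_cases u <;> fin_cases v <;> simp only [List.get_eq_getElem] at * <;> simp <;> omega

lemma contains_0132_of {π : List ℕ} {i j k l : Fin π.length}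
    (hij : i < j) (hjk : j < k) (hkl : k < l)
    (h₁ : π.get i < π.get j) (h₂ : π.get j < π.get l) (h₃ : π.get l < π.get k) :
    Contains π [0, 1, 3, 2] := by
  refine contains_four hij hjk hkl fun u v => ?_
  fin_cases u <;> fin_cases v <;> simp only [List.get_eq_getElem] at * <;> simp <;> omega

lemma contains_1032_of {π : List ℕ} {i j k l : Fin π.length}
    (hij : i < j) (hjk : j < k) (hkl : k < l)
    (h₁ : π.get j < π.get i) (h₂ : π.get i < π.get l) (h₃ : π.get l < π.get k) :
    Contains π [1, 0, 3, 2] := by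
  refine contains_four hij hjk hkl fun u v => ?_
  fin_cases u <;> fin_cases v <;> simp only [List.get_eq_getElem] at * <;> simp <;> omega

/-- A weakly increasing word with entries at most `M` and first entry `a` has at most `M - a`
ascents. -/
lemma numAscents_add_head_le {M : ℕ} (w : List ℕ) (a : ℕ) (hw : (a :: w).Pairwise (· ≤ ·))
    (hM : ∀ x ∈ a :: w, x ≤ M) : numAscents (a :: w) + a ≤ M := by
  induction w generalizing a with
  | nil => simpa [numAscents] using hM
  | cons b w ih =>
    have hrec := ih b hw.tail fun x hx => hM x (List.mem_cons_of_mem _ hx)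
    have hab : a ≤ b := List.rel_of_pairwise_cons hw (by simp)
    have hstep : numAscents (a :: b :: w) = numAscents (b :: w) + if a < b then 1 else 0 := by
      simp [numAscents, List.countP_cons]
    split_ifs at hstep <;> omega

namespace IsAscentSeq

variable {w : List ℕ}

lemma length_pos (hw : IsAscentSeq w) : 0 < w.length := by
  rcases w with _ | ⟨a, w⟩
  · simpa using hw.1
  · simp

lemma get_zero (hw : IsAscentSeq w) : w.get ⟨0, hw.length_pos⟩ = 0 := by
  rcases w with _ | ⟨a, w⟩ <;> simpa using hw.1

lemma contains_0132_of_contains_1032 (hw : IsAscentSeq w) (h : Contains w [1, 0, 3, 2]) :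
    Contains w [0, 1, 3, 2] := by
  obtain ⟨f, hf, hord⟩ := h
  have h₁ : w.get (f 1) < w.get (f 0) := (hord 1 0).1.2 (by simp)
  have h₂ : w.get (f 0) < w.get (f 3) := (hord 0 3).1.2 (by simp)
  have h₃ : w.get (f 3) < w.get (f 2) := (hord 3 2).1.2 (by simp)
  have h₀ := hw.get_zero
  have hpos : (⟨0, hw.length_pos⟩ : Fin w.length) < f 0 := by
    refine lt_of_le_of_ne (Nat.zero_le _) fun heq => ?_
    rw [← heq] at h₁
    omega
  exact contains_0132_of hpos (hf (by decide : (0 : Fin 4) < 2))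
    (hf (by decide : (2 : Fin 4) < 3)) (by omega) h₂ h₃

/-- In an ascent sequence, if `d` is the first entry exceeding a later entry `c ≥ 1`, then the
prefix before `d` either contains `c` (a 0121), or has a descent below `c` (a 1032), or has too
few ascents for `d` to occur. -/
lemma contains_0121_or_1032 (hw : IsAscentSeq w) {k l : Fin w.length} (hkl : k < l)
    (hpos : 0 < w.get l) (hlt : w.get l < w.get k) :
    Contains w [0, 1, 2, 1] ∨ Contains w [1, 0, 3, 2] := by
  by_contra! ⟨h0121, h1032⟩
  have h₀ := hw.get_zero
  obtain ⟨d, ⟨hdl, hd⟩, hmin⟩ := WellFounded.has_min (wellFounded_lt (α := Fin w.length))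
    {d | d < l ∧ w.get l < w.get d} ⟨k, hkl, hlt⟩
  have hbefore : ∀ x < d, w.get x < w.get l := by
    intro x hx
    have hle : w.get x ≤ w.get l := by
      by_contra! hgt
      exact hmin x ⟨hx.trans hdl, hgt⟩ hx
    refine lt_of_le_of_ne hle fun heq => h0121 ?_
    have hx0 : (⟨0, hw.length_pos⟩ : Fin w.length) < x := by
      refine lt_of_le_of_ne (Nat.zero_le _) fun hx0 => ?_
      rw [← hx0] at heq
      omega
    exact contains_0121_of hx0 hx hdl (by omega) (by omega) heq.symm
  have hmono : ∀ x y, x < y → y < d → w.get x ≤ w.get y := by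
    intro x y hxy hyd
    by_contra! hgt
    exact h1032 (contains_1032_of hxy hyd hdl hgt (hbefore x (hxy.trans hyd)) hd)
  have hd1 : 1 ≤ d.val := by
    by_contra! hd0
    have : d = ⟨0, hw.length_pos⟩ := Fin.ext (by simpa using hd0)
    rw [this] at hd
    omega
  have hsorted : (w.take d).Pairwise (· ≤ ·) := by
    rw [List.pairwise_iff_getElem]
    intro x y hx hy hxy
    simp only [List.length_take] at hx hy
    simpa using hmono ⟨x, by omega⟩ ⟨y, by omega⟩ hxy (Fin.lt_def.2 (by simp; omega))
  have hbound : ∀ x ∈ w.take d, x ≤ w.get l - 1 := by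
    intro x hx
    obtain ⟨y, hy, rfl⟩ := List.mem_iff_getElem.1 hx
    simp only [List.length_take] at hy
    have := hbefore ⟨y, by omega⟩ (Fin.lt_def.2 (by simp; omega))
    simp only [List.get_eq_getElem, List.getElem_take] at this ⊢
    omega
  have hasc := hw.2 d d.isLt hd1
  rcases hp : w.take d with _ | ⟨a, p⟩
  · have := congrArg List.length hp
    simp only [List.length_take, List.length_nil] at this
    omega
  · rw [hp] at hsorted hbound hasc
    have := numAscents_add_head_le p a hsorted hbound
    simp only [Fin.eta] at hasc
    omega

lemma contains_1032_of_contains_0132 (hw : IsAscentSeq w) (h0121 : Avoids w [0, 1, 2, 1])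
    (h : Contains w [0, 1, 3, 2]) : Contains w [1, 0, 3, 2] := by
  obtain ⟨f, hf, hord⟩ := h
  have h₁ : w.get (f 1) < w.get (f 3) := (hord 1 3).1.2 (by simp)
  have h₂ : w.get (f 3) < w.get (f 2) := (hord 3 2).1.2 (by simp)
  exact (hw.contains_0121_or_1032 (hf (by decide : (2 : Fin 4) < 3)) (by omega) h₂).resolve_left
    h0121

lemma avoids_0132_iff_avoids_1032 (hw : IsAscentSeq w) (h0121 : Avoids w [0, 1, 2, 1]) :
    Avoids w [0, 1, 3, 2] ↔ Avoids w [1, 0, 3, 2] :=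
  not_congr ⟨hw.contains_1032_of_contains_0132 h0121, hw.contains_0132_of_contains_1032⟩

end IsAscentSeq


/-- `𝒮_n(0121,0132) = 𝒮_n(0121,1032) = 𝒮_n(0121,0132,1032)`: among ascent sequences
avoiding 0121, avoiding 0132 is equivalent to avoiding 1032. -/
theorem avoiderSet_0121_0132_eq_0121_1032 (n : ℕ) (hn : 1 ≤ n) :
    avoiderSet n [[0,1,2,1], [0,1,3,2]] = avoiderSet n [[0,1,2,1], [1,0,3,2]] ∧
    avoiderSet n [[0,1,2,1], [1,0,3,2]] = avoiderSet n [[0,1,2,1], [0,1,3,2], [1,0,3,2]] := by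
  constructor <;> ext w <;>
    simp only [avoiderSet, Set.mem_ofPred_eq, List.forall_mem_cons, List.not_mem_nil,
      false_imp_iff, implies_true, and_true] <;>
    have := IsAscentSeq.avoids_0132_iff_avoids_1032 (w := w) <;>
    tauto
end

section
/- For every integer n ≥ 1, there exists a bijection φ from the set of ascent sequences of length n avoiding both patterns 0011 and 0021 onto the set of Dyck paths of semilength n such that for every such ascent sequence u, the number of letters equal to 0 in u equals the number of components of φ(u). -/
/-- A Dyck path, encoded as a list of `Bool` (`true` = up-step `U`, `false` = down-step `D`):
equally many `U`s and `D`s, and every prefix has at least as many `U`s as `D`s. -/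
def IsDyckPath (p : List Bool) : Prop :=
  p.count true = p.count false ∧
    ∀ k ≤ p.length, (p.take k).count false ≤ (p.take k).count true

/-- The number of components of a Dyck path, i.e. the number of returns: noninitial
vertices on the x-axis. -/
def dyckComponents (p : List Bool) : ℕ :=
  ((List.range p.length).filter
    (fun i => (p.take (i + 1)).count true = (p.take (i + 1)).count false)).length

/-! ### Ballot numbers -/

/-- The ballot number counting Dyck paths of semilength `m` with `j` components, defined by
its tail-sum recurrence. -/
def ballot : ℕ → ℕ → ℕ
  | 0, 0 => 1
  | 0, _ + 1 => 0
  | _ + 1, 0 => 0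
  | m + 1, j + 1 => ∑ i ∈ Finset.Ico j (m + 1), ballot m i

theorem ballot_eq_zero_of_lt {m j : ℕ} (h : m < j) : ballot m j = 0 := by
  cases j with
  | zero => omega
  | succ j =>
    cases m with
    | zero => simp [ballot]
    | succ m => rw [ballot, Finset.Ico_eq_empty (by omega), Finset.sum_empty]

theorem ballot_succ_succ (m j : ℕ) :
    ballot (m + 1) (j + 1) = ballot (m + 1) (j + 2) + ballot m j := by
  rcases Nat.lt_or_ge m j with h | h
  · rw [ballot_eq_zero_of_lt (by omega), ballot_eq_zero_of_lt (by omega),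
      ballot_eq_zero_of_lt h]
  · rw [ballot, ballot, Finset.sum_eq_sum_Ico_succ_bot (by omega), add_comm]

/-! ### Counting Dyck paths by components -/

/-- `p` is a lattice path from height `h` down to the x-axis that never goes below it. -/
def IsPathFrom (h : ℕ) (p : List Bool) : Prop :=
  h + p.count true = p.count false ∧
    ∀ k ≤ p.length, (p.take k).count false ≤ h + (p.take k).count true

/-- The number of noninitial vertices on the x-axis of the path `p` started at height `h`. -/
def returnsFrom (h : ℕ) (p : List Bool) : ℕ :=
  ((List.range p.length).filter
    (fun i => h + (p.take (i + 1)).count true = (p.take (i + 1)).count false)).length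

theorem isPathFrom_nil (h : ℕ) : IsPathFrom h [] ↔ h = 0 := by
  simp [IsPathFrom]

theorem isPathFrom_true_cons (h : ℕ) (p : List Bool) :
    IsPathFrom h (true :: p) ↔ IsPathFrom (h + 1) p := by
  unfold IsPathFrom
  refine and_congr (by simp; omega) ⟨fun H k hk => ?_, fun H k hk => ?_⟩
  · have := H (k + 1) (by simpa using hk)
    simp at this; omega
  · cases k with
    | zero => simp
    | succ k =>
      have := H k (by simpa using hk)
      simp; omega

theorem isPathFrom_succ_false_cons (h : ℕ) (p : List Bool) :
    IsPathFrom (h + 1) (false :: p) ↔ IsPathFrom h p := by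
  unfold IsPathFrom
  refine and_congr (by simp; omega) ⟨fun H k hk => ?_, fun H k hk => ?_⟩
  · have := H (k + 1) (by simpa using hk)
    simp at this; omega
  · cases k with
    | zero => simp
    | succ k =>
      have := H k (by simpa using hk)
      simp; omega

theorem not_isPathFrom_zero_false_cons (p : List Bool) : ¬ IsPathFrom 0 (false :: p) := by
  intro H
  have := H.2 1 (by simp)
  simp at this

theorem returnsFrom_true_cons (h : ℕ) (p : List Bool) :
    returnsFrom h (true :: p) = returnsFrom (h + 1) p := by
  unfold returnsFrom
  rw [List.length_cons, List.range_succ_eq_map, List.filter_cons_of_neg (by simp),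
    List.filter_map, List.length_map]
  congr 2
  funext i
  simp; omega

theorem returnsFrom_succ_false_cons (h : ℕ) (p : List Bool) :
    returnsFrom (h + 1) (false :: p) = returnsFrom h p + if h = 0 then 1 else 0 := by
  have key : ((List.map Nat.succ (List.range p.length)).filter
      (fun i => (h + 1) + ((false :: p).take (i + 1)).count true =
        ((false :: p).take (i + 1)).count false)).length = returnsFrom h p := by
    rw [List.filter_map, List.length_map, returnsFrom]
    congr 2
    funext i
    simp; omega
  conv_lhs => unfold returnsFrom
  rw [List.length_cons, List.range_succ_eq_map, List.filter_cons, ← key]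
  split_ifs with h1 h2 h2 <;> simp_all

/-- The paths of length `m` from height `h` to the x-axis that never go below it. -/
def pathsFrom : ℕ → ℕ → Finset (List Bool)
  | 0, 0 => {[]}
  | 0, _ + 1 => ∅
  | m + 1, 0 => (pathsFrom m 1).image (true :: ·)
  | m + 1, h + 1 => (pathsFrom m (h + 2)).image (true :: ·) ∪ (pathsFrom m h).image (false :: ·)

theorem mem_pathsFrom (m h : ℕ) (p : List Bool) :
    p ∈ pathsFrom m h ↔ p.length = m ∧ IsPathFrom h p := by
  induction m generalizing h p with
  | zero =>
    cases h with
    | zero =>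
      simp only [pathsFrom, Finset.mem_singleton, List.length_eq_zero_iff]
      exact ⟨fun H => ⟨H, H ▸ (isPathFrom_nil 0).2 rfl⟩, fun H => H.1⟩
    | succ h =>
      simp only [pathsFrom, Finset.notMem_empty, List.length_eq_zero_iff, false_iff]
      rintro ⟨rfl, H⟩
      exact absurd ((isPathFrom_nil _).1 H) (by omega)
  | succ m ih =>
    cases h with
    | zero =>
      rcases p with _ | ⟨b, p⟩
      · simp [pathsFrom]
      · cases b
        · simp [pathsFrom, not_isPathFrom_zero_false_cons]
        · simp [pathsFrom, ih, isPathFrom_true_cons]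
    | succ h =>
      rcases p with _ | ⟨b, p⟩
      · simp [pathsFrom]
      · cases b
        · simp [pathsFrom, ih, isPathFrom_succ_false_cons]
        · simp [pathsFrom, ih, isPathFrom_true_cons]

/-- The number of paths of length `m` from height `h` with `k` returns. -/
def numPaths (m h k : ℕ) : ℕ := ((pathsFrom m h).filter (fun p => returnsFrom h p = k)).card

theorem numPaths_succ_zero (m k : ℕ) : numPaths (m + 1) 0 k = numPaths m 1 k := by
  unfold numPaths
  rw [pathsFrom, Finset.filter_image, Finset.card_image_of_injective _ (List.cons_injective)]
  simp only [returnsFrom_true_cons]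

theorem numPaths_succ_succ (m h k : ℕ) :
    numPaths (m + 1) (h + 1) k = numPaths m (h + 2) k +
      ((pathsFrom m h).filter
        (fun p => returnsFrom h p + (if h = 0 then 1 else 0) = k)).card := by
  unfold numPaths
  rw [pathsFrom, Finset.filter_union, Finset.card_union_of_disjoint, Finset.filter_image,
    Finset.filter_image, Finset.card_image_of_injective _ (List.cons_injective),
    Finset.card_image_of_injective _ (List.cons_injective)]
  · simp only [returnsFrom_true_cons, returnsFrom_succ_false_cons]
  · refine Finset.disjoint_filter_filter ?_
    rw [Finset.disjoint_left]
    simp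

theorem numPaths_succ_one_zero (m : ℕ) : numPaths (m + 1) 1 0 = numPaths m 2 0 := by
  simp [numPaths_succ_succ]

theorem numPaths_succ_one_succ (m k : ℕ) :
    numPaths (m + 1) 1 (k + 1) = numPaths m 2 (k + 1) + numPaths m 0 k := by
  rw [numPaths_succ_succ]
  simp [numPaths]

theorem numPaths_succ_add_two (m h k : ℕ) :
    numPaths (m + 1) (h + 2) k = numPaths m (h + 3) k + numPaths m (h + 1) k := by
  rw [numPaths_succ_succ]
  simp [numPaths]

theorem numPaths_zero_succ (h k : ℕ) : numPaths 0 (h + 1) k = 0 := by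
  simp [numPaths, pathsFrom]

theorem numPaths_eq_zero_of_lt {m h : ℕ} (k : ℕ) (hm : m < h) : numPaths m h k = 0 := by
  unfold numPaths
  rw [Finset.card_eq_zero, Finset.filter_eq_empty_iff]
  intro p hp
  obtain ⟨hl, h1, -⟩ := (mem_pathsFrom _ _ _).1 hp
  have := List.count_le_length (a := false) (l := p)
  omega

theorem numPaths_succ_height_zero (m h : ℕ) : numPaths m (h + 1) 0 = 0 := by
  induction m generalizing h with
  | zero => exact numPaths_zero_succ _ _
  | succ m ih =>
    cases h with
    | zero => rw [numPaths_succ_one_zero, ih]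
    | succ h => rw [numPaths_succ_add_two, ih, ih]

theorem numPaths_eq_ballot (m : ℕ) :
    (∀ u k, m = 2 * u → numPaths m 0 k = ballot u k) ∧
      ∀ h u k, m = 2 * u + h + 1 →
        numPaths m (h + 1) (k + 1) = ballot (u + h + 1) (h + k + 1) := by
  induction m with
  | zero =>
    refine ⟨fun u k hu => ?_, fun h u k hu => by omega⟩
    obtain rfl : u = 0 := by omega
    cases k <;> simp [numPaths, pathsFrom, ballot, returnsFrom, Finset.filter_singleton]
  | succ m ih =>
    obtain ⟨ih0, ih1⟩ := ih
    refine ⟨fun u k hu => ?_, fun h u k hu => ?_⟩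
    · obtain ⟨u, rfl⟩ : ∃ v, u = v + 1 := ⟨u - 1, by omega⟩
      rw [numPaths_succ_zero]
      cases k with
      | zero => rw [numPaths_succ_height_zero, ballot]
      | succ k => simpa using ih1 0 u k (by omega)
    · have up : numPaths m (h + 2) (k + 1) = ballot (u + h + 1) (h + k + 2) := by
        cases u with
        | zero => rw [numPaths_eq_zero_of_lt _ (by omega), ballot_eq_zero_of_lt (by omega)]
        | succ u =>
          rw [ih1 (h + 1) u k (by omega)]
          congr 1 <;> omega
      rw [ballot_succ_succ, ← up]
      cases h with
      | zero => rw [numPaths_succ_one_succ, ih0 u k (by omega)]; simp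
      | succ h =>
        rw [numPaths_succ_add_two, ih1 h u k (by omega)]
        congr 2; omega

/-! ### The structure of avoiders -/

/-- The word `w` contains a subsequence `a a c b` with `a < b ≤ c`. -/
def HasBad (w : List ℕ) : Prop := ∃ a b c, a < b ∧ b ≤ c ∧ [a, a, c, b].Sublist w

/-- Appending the letter `x` to `p` completes a subsequence `a a c x` with `a < x ≤ c`. -/
def Blocks (p : List ℕ) (x : ℕ) : Prop := ∃ a c, a < x ∧ x ≤ c ∧ [a, a, c].Sublist p

theorem avoids_iff (w : List ℕ) :
    Avoids w [0, 0, 1, 1] ∧ Avoids w [0, 0, 2, 1] ↔ ¬ HasBad w := by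
  have key : Contains w [0, 0, 1, 1] ∨ Contains w [0, 0, 2, 1] ↔ HasBad w := by
    constructor
    · rintro (⟨f, hf, H⟩ | ⟨f, hf, H⟩)
      all_goals
        refine ⟨w.get (f 0), w.get (f 3), w.get (f 2), ?_, ?_, ?_⟩
        · exact (H 0 3).1.2 (by simp)
        · have := (H 2 3).1
          simp at this
          simpa using this
        · rw [List.sublist_iff_exists_fin_orderEmbedding_get_eq]
          refine ⟨OrderEmbedding.ofStrictMono f hf, fun i => ?_⟩
          have h1 := (H 0 1)
          have : w.get (f 1) = w.get (f 0) := by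
            simp at h1
            simp; omega
          fin_cases i
          · rfl
          · exact this.symm
          · rfl
          · rfl
    · rintro ⟨a, b, c, hab, hbc, hs⟩
      rw [List.sublist_iff_exists_fin_orderEmbedding_get_eq] at hs
      obtain ⟨f, hf⟩ := hs
      have h0 : w.get (f 0) = a := (hf 0).symm
      have h1 : w.get (f 1) = a := (hf 1).symm
      have h2 : w.get (f 2) = c := (hf 2).symm
      have h3 : w.get (f 3) = b := (hf 3).symm
      rcases hbc.eq_or_lt with rfl | hlt
      · refine Or.inl ⟨f, f.strictMono, fun i j => ?_⟩
        rw [← hf, ← hf]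
        fin_cases i <;> fin_cases j <;> simp <;> omega
      · refine Or.inr ⟨f, f.strictMono, fun i j => ?_⟩
        rw [← hf, ← hf]
        fin_cases i <;> fin_cases j <;> simp <;> omega
  rw [← key, not_or]; rfl

theorem List.concat_sublist_concat_iff {α : Type*} (l p : List α) (b x : α) :
    (l ++ [b]).Sublist (p ++ [x]) ↔ (l ++ [b]).Sublist p ∨ b = x ∧ l.Sublist p := by
  rw [← List.reverse_sublist]
  simp only [List.reverse_append, List.reverse_singleton, List.singleton_append]
  rw [← List.reverse_sublist (l₁ := l ++ [b]), ← List.reverse_sublist (l₁ := l)]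
  simp only [List.reverse_append, List.reverse_singleton, List.singleton_append]
  constructor
  · intro h
    cases h with
    | cons _ h => exact Or.inl h
    | cons_cons _ h => exact Or.inr ⟨rfl, h⟩
  · rintro (h | ⟨rfl, h⟩)
    · exact h.cons _
    · exact h.cons_cons _

theorem hasBad_concat (p : List ℕ) (x : ℕ) : HasBad (p ++ [x]) ↔ HasBad p ∨ Blocks p x := by
  constructor
  · rintro ⟨a, b, c, hab, hbc, hs⟩
    rcases (List.concat_sublist_concat_iff [a, a, c] p b x).1 hs with h | ⟨rfl, h⟩
    · exact Or.inl ⟨a, b, c, hab, hbc, h⟩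
    · exact Or.inr ⟨a, c, hab, hbc, h⟩
  · rintro (⟨a, b, c, hab, hbc, hs⟩ | ⟨a, c, hab, hbc, hs⟩)
    · exact ⟨a, b, c, hab, hbc, hs.trans (List.sublist_append_left _ _)⟩
    · exact ⟨a, x, c, hab, hbc,
        (List.concat_sublist_concat_iff [a, a, c] p x x).2 (Or.inr ⟨rfl, hs⟩)⟩

theorem blocks_concat (p : List ℕ) (x y : ℕ) :
    Blocks (p ++ [x]) y ↔ Blocks p y ∨ y ≤ x ∧ ∃ a < y, [a, a].Sublist p := by
  constructor
  · rintro ⟨a, c, hab, hbc, hs⟩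
    rcases (List.concat_sublist_concat_iff [a, a] p c x).1 hs with h | ⟨rfl, h⟩
    · exact Or.inl ⟨a, c, hab, hbc, h⟩
    · exact Or.inr ⟨hbc, a, hab, h⟩
  · rintro (⟨a, c, hab, hbc, hs⟩ | ⟨hbc, a, hab, hs⟩)
    · exact ⟨a, c, hab, hbc, hs.trans (List.sublist_append_left _ _)⟩
    · exact ⟨a, x, hab, hbc,
        (List.concat_sublist_concat_iff [a, a] p x x).2 (Or.inr ⟨rfl, hs⟩)⟩

theorem not_blocks_zero (p : List ℕ) : ¬ Blocks p 0 := by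
  rintro ⟨a, c, h, -⟩
  omega

theorem numAscents_concat_concat (p : List ℕ) (l x : ℕ) :
    numAscents (p ++ [l] ++ [x]) = numAscents (p ++ [l]) + if l < x then 1 else 0 := by
  induction p with
  | nil => simp [numAscents, List.countP_cons]
  | cons a p ih =>
    rcases p with _ | ⟨b, p⟩
    · simp [numAscents, List.countP_cons]; omega
    · simp only [numAscents, List.cons_append, List.tail_cons, List.zip_cons_cons,
        List.countP_cons] at ih ⊢
      omega

theorem isAscentSeq_concat {p : List ℕ} (hp : p ≠ []) (x : ℕ) :
    IsAscentSeq (p ++ [x]) ↔ IsAscentSeq p ∧ x ≤ numAscents p + 1 := by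
  have hpos : 1 ≤ p.length := List.length_pos_iff.2 hp
  unfold IsAscentSeq
  rw [List.head?_append_of_ne_nil _ hp, and_assoc]
  refine and_congr_right fun _ => ⟨fun H => ⟨fun i hi h1 => ?_, ?_⟩, ?_⟩
  · have := H i (by simp; omega) h1
    rw [List.take_append_of_le_length hi.le] at this
    simpa [List.getElem_append_left hi] using this
  · have := H p.length (by simp) hpos
    simpa using this
  · rintro ⟨H, hx⟩ i hi h1
    rcases Nat.lt_or_ge i p.length with h | h
    · rw [List.take_append_of_le_length h.le]
      simpa [List.getElem_append_left h] using H i h h1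
    · obtain rfl : i = p.length := by simp at hi; omega
      simpa using hx

/-- Ascent sequences avoiding both `0011` and `0021`. -/
def IsAvoider (w : List ℕ) : Prop := IsAscentSeq w ∧ ¬ HasBad w

theorem isAvoider_singleton (x : ℕ) : IsAvoider [x] ↔ x = 0 := by
  constructor
  · rintro ⟨⟨h, -⟩, -⟩
    simpa using h
  · rintro rfl
    refine ⟨⟨rfl, fun i hi h1 => ?_⟩, ?_⟩
    · simp at hi; omega
    · rintro ⟨a, b, c, -, -, h⟩
      have := h.length_le
      simp at this

theorem isAvoider_concat {p : List ℕ} (hp : p ≠ []) (x : ℕ) :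
    IsAvoider (p ++ [x]) ↔ IsAvoider p ∧ x ≤ numAscents p + 1 ∧ ¬ Blocks p x := by
  unfold IsAvoider
  rw [isAscentSeq_concat hp, hasBad_concat]
  tauto

theorem IsAvoider.ne_nil {w : List ℕ} (h : IsAvoider w) : w ≠ [] := by
  rintro rfl
  simpa using h.1.1

theorem IsAvoider.le_numAscents {w : List ℕ} (h : IsAvoider w) : ∀ x ∈ w, x ≤ numAscents w := by
  induction w using List.reverseRecOn with
  | nil => simp
  | append_singleton p x ih =>
    rcases List.eq_nil_or_concat' p with rfl | ⟨q, l, rfl⟩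
    · have := (isAvoider_singleton x).1 h
      simp [this]
    · obtain ⟨hp, hx, -⟩ := (isAvoider_concat (by simp) x).1 h
      have ih := ih hp
      rw [numAscents_concat_concat]
      intro y hy
      rcases List.mem_append.1 hy with hy | hy
      · have := ih y hy
        omega
      · obtain rfl := List.mem_singleton.1 hy
        have := ih l (by simp)
        split_ifs <;> omega

theorem numAscents_lt_length {w : List ℕ} (h : w ≠ []) : numAscents w < w.length := by
  induction w using List.reverseRecOn with
  | nil => exact absurd rfl h
  | append_singleton p x ih =>
    rcases List.eq_nil_or_concat' p with rfl | ⟨q, l, rfl⟩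
    · simp [numAscents]
    · have := ih (by simp)
      rw [numAscents_concat_concat, List.length_append, List.length_singleton]
      split_ifs <;> omega

open Classical in
/-- The positive letters that can be appended to the avoider `p`. -/
noncomputable def posLetters (p : List ℕ) : Finset ℕ :=
  (Finset.Icc 1 (numAscents p + 1)).filter (fun x => ¬ Blocks p x)

theorem mem_posLetters {p : List ℕ} {x : ℕ} :
    x ∈ posLetters p ↔ 1 ≤ x ∧ x ≤ numAscents p + 1 ∧ ¬ Blocks p x := by
  simp [posLetters, and_assoc]

theorem isAvoider_concat_iff_mem {p : List ℕ} (hp : p ≠ []) (x : ℕ) :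
    IsAvoider (p ++ [x]) ↔ IsAvoider p ∧ x ∈ insert 0 (posLetters p) := by
  rw [isAvoider_concat hp, Finset.mem_insert, mem_posLetters]
  rcases Nat.eq_zero_or_pos x with rfl | hx
  · simp [not_blocks_zero]
  · have : x ≠ 0 := by omega
    have : 1 ≤ x := hx
    tauto

theorem numAscents_concat_zero (p : List ℕ) : numAscents (p ++ [0]) = numAscents p := by
  rcases List.eq_nil_or_concat' p with rfl | ⟨q, l, rfl⟩
  · simp [numAscents]
  · rw [numAscents_concat_concat]; simp

theorem posLetters_concat_zero (p : List ℕ) : posLetters (p ++ [0]) = posLetters p := by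
  ext y
  rw [mem_posLetters, mem_posLetters, numAscents_concat_zero, blocks_concat]
  refine and_congr_right fun h1 => and_congr_right fun _ => not_congr ?_
  exact or_iff_left fun h => by omega

theorem two_le_count_iff {w : List ℕ} : 2 ≤ w.count 0 ↔ [0, 0].Sublist w :=
  List.replicate_sublist_iff.symm

theorem numAscents_concat_of_mem {p : List ℕ} {x : ℕ} (hz : 2 ≤ p.count 0)
    (hx : x ∈ posLetters p) : numAscents (p ++ [x]) = numAscents p + 1 := by
  rw [mem_posLetters] at hx
  rcases List.eq_nil_or_concat' p with rfl | ⟨q, l, rfl⟩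
  · simp at hz
  · rw [numAscents_concat_concat, if_pos]
    by_contra hl
    refine hx.2.2 ((blocks_concat q l x).2 (Or.inr ⟨by omega, 0, by omega, ?_⟩))
    rw [← two_le_count_iff]
    have : l ≠ 0 := by omega
    simpa [List.count_append, List.count_singleton, this] using hz

theorem card_posLetters_concat {p : List ℕ} {x : ℕ} (hp : IsAvoider p) (hz : 2 ≤ p.count 0)
    (hx : x ∈ posLetters p) :
    (posLetters (p ++ [x])).card = ((posLetters p).filter (fun y => x < y)).card + 1 := by
  have : posLetters (p ++ [x]) =
      insert (numAscents p + 2) ((posLetters p).filter (fun y => x < y)) := by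
    ext y
    have hx' := mem_posLetters.1 hx
    rw [Finset.mem_insert, Finset.mem_filter, mem_posLetters, mem_posLetters,
      numAscents_concat_of_mem hz hx, blocks_concat]
    constructor
    · rintro ⟨h1, h2, h3⟩
      have hxy : x < y := by
        by_contra hxy
        exact h3 (Or.inr ⟨by omega, 0, by omega, two_le_count_iff.1 hz⟩)
      rcases Nat.lt_or_ge (numAscents p + 1) y with h | h
      · left; omega
      · exact Or.inr ⟨⟨h1, h, fun h => h3 (Or.inl h)⟩, hxy⟩
    · rintro (rfl | ⟨⟨h1, h2, h3⟩, h4⟩)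
      · refine ⟨by omega, by omega, ?_⟩
        rintro (⟨a, c, -, hc, hs⟩ | ⟨h, -⟩)
        · have := hp.le_numAscents c (hs.subset (by simp))
          omega
        · omega
      · refine ⟨h1, by omega, ?_⟩
        rintro (h | ⟨h, -⟩)
        · exact h3 h
        · omega
  rw [this, Finset.card_insert_of_notMem]
  simp [mem_posLetters]

/-! ### Avoiders with a single zero -/

/-- Raise all letters by one and prepend a zero. -/
def lift (w : List ℕ) : List ℕ := 0 :: w.map Nat.succ

theorem lift_injective : Function.Injective lift := by
  intro v w h
  exact List.map_injective_iff.2 Nat.succ_injective (List.cons_injective h)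

theorem lift_concat (p : List ℕ) (x : ℕ) : lift (p ++ [x]) = lift p ++ [x + 1] := by
  simp [lift]

theorem count_zero_lift (w : List ℕ) : (lift w).count 0 = 1 := by
  have : (w.map Nat.succ).count 0 = 0 := List.count_eq_zero.2 (by simp)
  simp [lift, this]

theorem numAscents_lift {w : List ℕ} (hw : w ≠ []) : numAscents (lift w) = numAscents w + 1 := by
  induction w using List.reverseRecOn with
  | nil => exact absurd rfl hw
  | append_singleton p x ih =>
    rcases List.eq_nil_or_concat' p with rfl | ⟨q, l, rfl⟩
    · simp [numAscents, lift]
    · rw [lift_concat, lift_concat, numAscents_concat_concat, ← lift_concat, ih (by simp),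
        numAscents_concat_concat]
      simp; omega

theorem blocks_lift (w : List ℕ) (x : ℕ) : Blocks (lift w) (x + 1) ↔ Blocks w x := by
  constructor
  · rintro ⟨a, c, hac, hc, hs⟩
    have ha : a ≠ 0 := by
      rintro rfl
      have h2 : [0, 0].Sublist (lift w) := List.Sublist.trans (by simp) hs
      have := two_le_count_iff.2 h2
      rw [count_zero_lift] at this
      omega
    have hs' : [a, a, c].Sublist (w.map Nat.succ) := by
      cases hs with
      | cons _ h => exact h
      | cons_cons _ h => exact absurd rfl ha
    refine ⟨a - 1, c - 1, by omega, by omega, ?_⟩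
    simpa [Function.comp_def] using hs'.map Nat.pred
  · rintro ⟨a, c, hac, hc, hs⟩
    exact ⟨a + 1, c + 1, by omega, by omega, (hs.map Nat.succ).cons _⟩

theorem isAvoider_lift {w : List ℕ} (hw : w ≠ []) : IsAvoider (lift w) ↔ IsAvoider w := by
  induction w using List.reverseRecOn with
  | nil => exact absurd rfl hw
  | append_singleton p x ih =>
    rw [lift_concat, isAvoider_concat (by simp [lift]), blocks_lift]
    rcases List.eq_nil_or_concat' p with rfl | ⟨q, l, rfl⟩
    · have h0 : lift [] = [0] := rfl
      have hb : ¬ Blocks [] x := by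
        rintro ⟨a, c, -, -, h⟩
        simpa using h.length_le
      simp [h0, isAvoider_singleton, hb, numAscents]
    · rw [isAvoider_concat (by simp), ih (by simp), numAscents_lift (by simp)]
      simp

theorem card_posLetters_lift {w : List ℕ} (hw : w ≠ []) :
    (posLetters (lift w)).card = (posLetters w).card + 1 := by
  have : posLetters (lift w) = (insert 0 (posLetters w)).image Nat.succ := by
    ext y
    rw [mem_posLetters, numAscents_lift hw, Finset.mem_image]
    constructor
    · rintro ⟨h1, h2, h3⟩
      obtain ⟨y, rfl⟩ : ∃ z, y = z + 1 := ⟨y - 1, by omega⟩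
      rw [blocks_lift] at h3
      refine ⟨y, ?_, rfl⟩
      rw [Finset.mem_insert, mem_posLetters]
      rcases Nat.eq_zero_or_pos y with h | h
      · exact Or.inl h
      · exact Or.inr ⟨h, by omega, h3⟩
    · rintro ⟨z, hz, rfl⟩
      rw [Finset.mem_insert, mem_posLetters] at hz
      rw [Nat.succ_eq_add_one, blocks_lift]
      rcases hz with rfl | ⟨h1, h2, h3⟩
      · exact ⟨by omega, by omega, not_blocks_zero w⟩
      · exact ⟨by omega, by omega, h3⟩
  rw [this, Finset.card_image_of_injective _ Nat.succ_injective, Finset.card_insert_of_notMem]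
  simp [mem_posLetters]

theorem exists_eq_lift {w : List ℕ} (hw : IsAvoider w) (hz : w.count 0 = 1) :
    ∃ v, w = lift v := by
  rcases w with _ | ⟨a, t⟩
  · exact absurd rfl hw.ne_nil
  · obtain rfl : a = 0 := by simpa using hw.1.1
    have h0 : 0 ∉ t := List.count_eq_zero.1 (by simpa using hz)
    refine ⟨t.map Nat.pred, ?_⟩
    rw [lift, List.map_map]
    congr 1
    symm
    conv_rhs => rw [← List.map_id t]
    refine List.map_congr_left fun x hx => ?_
    have : x ≠ 0 := fun h => h0 (h ▸ hx)
    simp; omega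

/-! ### Counting avoiders by zeros and by admissible letters -/

/-- The avoiders of length `n + 1`. -/
noncomputable def avoiders : ℕ → Finset (List ℕ)
  | 0 => {[0]}
  | n + 1 => (avoiders n).biUnion fun p => (insert 0 (posLetters p)).image fun x => p ++ [x]

theorem mem_avoiders (n : ℕ) (w : List ℕ) :
    w ∈ avoiders n ↔ w.length = n + 1 ∧ IsAvoider w := by
  induction n generalizing w with
  | zero =>
    rw [avoiders, Finset.mem_singleton, zero_add, List.length_eq_one_iff]
    constructor
    · rintro rfl
      exact ⟨⟨0, rfl⟩, (isAvoider_singleton 0).2 rfl⟩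
    · rintro ⟨⟨x, rfl⟩, h⟩
      rw [(isAvoider_singleton x).1 h]
  | succ n ih =>
    simp only [avoiders, Finset.mem_biUnion, Finset.mem_image, ih]
    constructor
    · rintro ⟨p, ⟨hl, hp⟩, x, hx, rfl⟩
      exact ⟨by simp [hl], (isAvoider_concat_iff_mem hp.ne_nil x).2 ⟨hp, hx⟩⟩
    · rintro ⟨hl, hw⟩
      rcases List.eq_nil_or_concat' w with rfl | ⟨p, x, rfl⟩
      · simp at hl
      · have hlp : p.length = n + 1 := by simpa using hl
        have hne : p ≠ [] := by rintro rfl; simp at hlp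
        obtain ⟨hp, hx⟩ := (isAvoider_concat_iff_mem hne x).1 hw
        exact ⟨p, ⟨hlp, hp⟩, x, hx, rfl⟩

theorem sum_avoiders_succ (n : ℕ) (f : List ℕ → ℕ) :
    ∑ w ∈ avoiders (n + 1), f w =
      ∑ p ∈ avoiders n, (f (p ++ [0]) + ∑ x ∈ posLetters p, f (p ++ [x])) := by
  rw [avoiders, Finset.sum_biUnion]
  · refine Finset.sum_congr rfl fun p _ => ?_
    rw [Finset.sum_image (by intro x _ y _ h; simpa using h), Finset.sum_insert]
    simp [mem_posLetters]
  · intro p _ q _ hpq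
    rw [Function.onFun, Finset.disjoint_left]
    intro w hw hw'
    obtain ⟨x, -, rfl⟩ := Finset.mem_image.1 hw
    obtain ⟨y, -, h⟩ := Finset.mem_image.1 hw'
    exact hpq (List.append_inj_left' h rfl).symm

theorem card_filter_card_filter_lt_eq (S : Finset ℕ) (i : ℕ) :
    (S.filter (fun x => (S.filter (fun y => x < y)).card = i)).card =
      if i < S.card then 1 else 0 := by
  induction S using Finset.induction_on_max generalizing i with
  | empty => simp
  | insert a S hmax ih =>
    have ha : a ∉ S := fun h => lt_irrefl _ (hmax a h)
    have htop : (insert a S).filter (fun y => a < y) = ∅ := by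
      rw [Finset.filter_eq_empty_iff]
      intro y hy
      rcases Finset.mem_insert.1 hy with rfl | hy
      · simp
      · exact not_lt.2 (hmax y hy).le
    have hrest : S.filter (fun x => ((insert a S).filter (fun y => x < y)).card = i) =
        S.filter (fun x => (S.filter (fun y => x < y)).card + 1 = i) := by
      refine Finset.filter_congr fun x hx => ?_
      rw [Finset.filter_insert, if_pos (hmax x hx), Finset.card_insert_of_notMem (by simp [ha])]
    rw [Finset.filter_insert, htop, hrest, Finset.card_insert_of_notMem ha, Finset.card_empty]
    cases i with
    | zero => simp
    | succ i => simpa using ih i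

/-- The number of avoiders of length `n + 1` with `k` zeros and `e` admissible positive
letters. -/
noncomputable def numAvoiders (n k e : ℕ) : ℕ :=
  ((avoiders n).filter (fun w => w.count 0 = k ∧ (posLetters w).card = e)).card

theorem count_zero_le {n : ℕ} {w : List ℕ} (hw : w ∈ avoiders n) : w.count 0 ≤ n + 1 := by
  rw [← ((mem_avoiders _ _).1 hw).1]
  exact List.count_le_length

theorem card_posLetters_le {n : ℕ} {w : List ℕ} (hw : w ∈ avoiders n) :
    (posLetters w).card ≤ n + 1 := by
  obtain ⟨hl, hA⟩ := (mem_avoiders _ _).1 hw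
  have h1 := numAscents_lt_length hA.ne_nil
  have h2 : (posLetters w).card ≤ (Finset.Icc 1 (numAscents w + 1)).card :=
    Finset.card_le_card fun x hx =>
      have hx := mem_posLetters.1 hx
      Finset.mem_Icc.2 ⟨hx.1, hx.2.1⟩
  rw [Nat.card_Icc] at h2
  omega

theorem numAvoiders_succ_one (n e : ℕ) :
    numAvoiders (n + 1) 1 (e + 1) =
      ((avoiders n).filter (fun w => (posLetters w).card = e)).card := by
  rw [numAvoiders, ← Finset.card_image_of_injective ((avoiders n).filter _) lift_injective]
  refine congrArg Finset.card (Finset.ext fun w => ?_)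
  simp only [Finset.mem_filter, Finset.mem_image, mem_avoiders]
  constructor
  · rintro ⟨⟨hl, hw⟩, hz, he⟩
    obtain ⟨v, rfl⟩ := exists_eq_lift hw hz
    have hlv : v.length = n + 1 := by simpa [lift] using hl
    have hne : v ≠ [] := by rintro rfl; simp at hlv
    rw [card_posLetters_lift hne] at he
    exact ⟨v, ⟨⟨hlv, (isAvoider_lift hne).1 hw⟩, by omega⟩, rfl⟩
  · rintro ⟨v, ⟨⟨hl, hv⟩, he⟩, rfl⟩
    exact ⟨⟨by simp [lift, hl], (isAvoider_lift hv.ne_nil).2 hv⟩, count_zero_lift v,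
      by rw [card_posLetters_lift hv.ne_nil, he]⟩

theorem card_posLetters_ne_zero {w : List ℕ} (hw : IsAvoider w) : (posLetters w).card ≠ 0 := by
  refine Finset.card_ne_zero_of_mem (a := numAscents w + 1) ?_
  refine mem_posLetters.2 ⟨by omega, le_rfl, ?_⟩
  rintro ⟨a, c, -, hc, hs⟩
  have := hw.le_numAscents c (hs.subset (by simp))
  omega

theorem numAvoiders_succ_one_one (n : ℕ) : numAvoiders (n + 1) 1 1 = 0 := by
  rw [numAvoiders_succ_one, Finset.card_eq_zero, Finset.filter_eq_empty_iff]
  exact fun w hw => card_posLetters_ne_zero ((mem_avoiders n w).1 hw).2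

theorem numAvoiders_succ_add_two (n k e : ℕ) :
    numAvoiders (n + 1) (k + 2) (e + 1) = numAvoiders n (k + 1) (e + 1) +
      ((avoiders n).filter (fun w => w.count 0 = k + 2 ∧ e + 1 ≤ (posLetters w).card)).card := by
  simp only [numAvoiders, Finset.card_filter]
  rw [sum_avoiders_succ, Finset.sum_add_distrib]
  congr 1
  · refine Finset.sum_congr rfl fun p _ => ?_
    rw [posLetters_concat_zero]
    simp [List.count_append]
  · refine Finset.sum_congr rfl fun p hp => ?_
    have hp := ((mem_avoiders _ _).1 hp).2
    have hc : ∀ x ∈ posLetters p, (p ++ [x]).count 0 = p.count 0 := by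
      intro x hx
      have : x ≠ 0 := by have := (mem_posLetters.1 hx).1; omega
      simp [List.count_append, this]
    by_cases hk : p.count 0 = k + 2
    · have := card_filter_card_filter_lt_eq (posLetters p) e
      rw [Finset.card_filter] at this
      simp only [hk, true_and, Nat.add_one_le_iff]
      rw [← this]
      refine Finset.sum_congr rfl fun x hx => ?_
      rw [hc x hx, hk, card_posLetters_concat hp (by omega) hx]
      simp
    · rw [if_neg (by tauto)]
      refine Finset.sum_eq_zero fun x hx => ?_
      rw [hc x hx, if_neg (by tauto)]

/-- Summing ballot numbers over the values `≥ j` of a bounded statistic. -/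
theorem card_filter_le_eq_ballot {α : Type*} (S : Finset α) (g : α → ℕ) (m N b : ℕ)
    (hN : ∀ a ∈ S, g a ≤ N)
    (h : ∀ j, (S.filter (fun a => g a = j + 1)).card = ballot m (b + j)) (hb : m < b + N) (j : ℕ) :
    (S.filter (fun a => j + 1 ≤ g a)).card = ballot (m + 1) (b + j + 1) := by
  induction hd : N - j generalizing j with
  | zero =>
    rw [ballot_eq_zero_of_lt (by omega), Finset.card_eq_zero, Finset.filter_eq_empty_iff]
    intro a ha
    have := hN a ha
    omega
  | succ d ih =>
    have hsplit : S.filter (fun a => j + 1 ≤ g a) =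
        (S.filter (fun a => j + 1 + 1 ≤ g a)).disjUnion (S.filter (fun a => g a = j + 1))
          (Finset.disjoint_filter.2 fun a _ h1 h2 => by omega) := by
      ext a
      simp only [Finset.mem_filter, Finset.mem_disjUnion, ← and_or_left]
      exact and_congr_right fun _ => by omega
    rw [hsplit, Finset.card_disjUnion, h, ih (j + 1) (by omega), ballot_succ_succ m (b + j)]
    rfl

theorem count_zero_pos {w : List ℕ} (hw : IsAvoider w) : 1 ≤ w.count 0 :=
  List.count_pos_iff.2 (List.mem_of_head? hw.1.1)

theorem numAvoiders_eq_ballot (n k e : ℕ) :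
    numAvoiders n (k + 1) (e + 1) = ballot n (k + e) := by
  induction n generalizing k e with
  | zero =>
    have h1 : [0] ∈ avoiders 0 := Finset.mem_singleton_self _
    have h2 := card_posLetters_le h1
    have h3 := card_posLetters_ne_zero ((mem_avoiders _ _).1 h1).2
    have h4 : (posLetters [0]).card = 1 := by omega
    rw [numAvoiders, avoiders, Finset.filter_singleton, h4]
    rcases k with _ | k <;> rcases e with _ | e <;> simp [ballot]
  | succ n ih =>
    cases k with
    | zero =>
      rw [zero_add, zero_add]
      cases e with
      | zero =>
        exact numAvoiders_succ_one_one n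
      | succ e =>
        rw [numAvoiders_succ_one]
        have := card_filter_le_eq_ballot
          ((avoiders n).filter fun w => (posLetters w).card = e + 1) (fun w => w.count 0) n (n + 1) e
          (fun w hw => count_zero_le (Finset.mem_filter.1 hw).1)
          (fun j => by
            rw [Finset.filter_filter, add_comm e j, ← ih, numAvoiders]
            exact congrArg _ (Finset.filter_congr fun w _ => and_comm))
          (by omega) 0
        rw [add_zero] at this
        rw [← this]
        refine congrArg Finset.card (Finset.filter_true_of_mem fun w hw => ?_).symm
        exact count_zero_pos ((mem_avoiders _ _).1 (Finset.mem_filter.1 hw).1).2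
    | succ k =>
      rw [numAvoiders_succ_add_two, ih, add_right_comm k 1 e, ballot_succ_succ, add_comm]
      congr 1
      have := card_filter_le_eq_ballot
        ((avoiders n).filter fun w => w.count 0 = k + 2) (fun w => (posLetters w).card) n (n + 1)
        (k + 1) (fun w hw => card_posLetters_le (Finset.mem_filter.1 hw).1)
        (fun j => by
          rw [Finset.filter_filter, ← ih, numAvoiders])
        (by omega) e
      rw [Finset.filter_filter] at this
      rw [this]
      congr 1; omega

theorem card_avoiders_filter_count_zero (n k : ℕ) :
    ((avoiders n).filter (fun w => w.count 0 = k)).card = ballot (n + 1) k := by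
  cases k with
  | zero =>
    rw [ballot, Finset.card_eq_zero, Finset.filter_eq_empty_iff]
    intro w hw
    have := count_zero_pos ((mem_avoiders _ _).1 hw).2
    omega
  | succ k =>
    have := card_filter_le_eq_ballot
      ((avoiders n).filter fun w => w.count 0 = k + 1) (fun w => (posLetters w).card) n (n + 1)
      k (fun w hw => card_posLetters_le (Finset.mem_filter.1 hw).1)
      (fun j => by rw [Finset.filter_filter, ← numAvoiders_eq_ballot, numAvoiders])
      (by omega) 0
    rw [add_zero] at this
    rw [← this]
    congr 1
    refine (Finset.filter_true_of_mem fun w hw => ?_).symm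
    have := card_posLetters_ne_zero ((mem_avoiders _ _).1 (Finset.mem_filter.1 hw).1).2
    omega

theorem isDyckPath_iff (p : List Bool) : IsDyckPath p ↔ IsPathFrom 0 p := by
  simp [IsDyckPath, IsPathFrom]

theorem dyckComponents_eq (p : List Bool) : dyckComponents p = returnsFrom 0 p := by
  simp [dyckComponents, returnsFrom]

/-- There is a bijection `φ` from (0011,0021)-avoiding ascent sequences of length `n` to
Dyck paths of semilength `n` sending the number of 0s to the number of components. -/
theorem exists_bijection_avoiders_dyckPaths (n : ℕ) (hn : 1 ≤ n) :
    ∃ φ : {w : List ℕ // w.length = n ∧ IsAscentSeq w ∧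
            Avoids w [0,0,1,1] ∧ Avoids w [0,0,2,1]} →
          {p : List Bool // p.length = 2 * n ∧ IsDyckPath p},
      Function.Bijective φ ∧
        ∀ u, u.1.count 0 = dyckComponents (φ u).1 := by
  obtain ⟨n, rfl⟩ : ∃ m, n = m + 1 := ⟨n - 1, by omega⟩
  have hA (w : List ℕ) : (w.length = n + 1 ∧ IsAscentSeq w ∧
      Avoids w [0,0,1,1] ∧ Avoids w [0,0,2,1]) ↔ w ∈ avoiders n := by
    rw [avoids_iff, mem_avoiders, IsAvoider]
  have hD (p : List Bool) : (p.length = 2 * (n + 1) ∧ IsDyckPath p) ↔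
      p ∈ pathsFrom (2 * (n + 1)) 0 := by
    rw [mem_pathsFrom, isDyckPath_iff]
  have hcard (k : ℕ) : ((avoiders n).filter (fun w => w.count 0 = k)).card =
      ((pathsFrom (2 * (n + 1)) 0).filter (fun p => dyckComponents p = k)).card := by
    simp only [dyckComponents_eq]
    rw [card_avoiders_filter_count_zero, ← (numPaths_eq_ballot _).1 (n + 1) k rfl, numPaths]
  let e : {w : List ℕ // w.length = n + 1 ∧ IsAscentSeq w ∧
      Avoids w [0,0,1,1] ∧ Avoids w [0,0,2,1]} ≃
      {p : List Bool // p.length = 2 * (n + 1) ∧ IsDyckPath p} :=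
    Equiv.ofFiberEquiv (f := fun u => u.1.count 0) (g := fun p => dyckComponents p.1) fun k =>
      (Equiv.subtypeSubtypeEquivSubtypeInter _ (fun w : List ℕ => w.count 0 = k)).trans
        (((Equiv.subtypeEquivRight fun w => by rw [hA, Finset.mem_filter]).trans
          (Finset.equivOfCardEq (hcard k))).trans
            ((Equiv.subtypeEquivRight fun p => by rw [hD, Finset.mem_filter]).trans
              (Equiv.subtypeSubtypeEquivSubtypeInter _
                (fun p : List Bool => dyckComponents p = k)).symm))
  refine ⟨e, e.bijective, fun u => Eq.symm ?_⟩
  exact Equiv.ofFiberEquiv_map (f := fun u : {w : List ℕ // _} => u.1.count 0)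
    (g := fun p : {p : List Bool // _} => dyckComponents p.1) _ u
end
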